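/- Sufficiency part of the scaling theorem for the additive kernel: Let ν₀ be a positive Radon measure on (0,∞) with ∫ x ν₀(dx) = 1, let (ν_t)_{t≥0} be the solution of Smoluchowski's coagulation equation with kernel K=x+y and initial data ν₀, and set M(t,x) = ∫₀^x y ν_t(dy). Suppose there exist ρ ∈ (0,1] and a function L slowly varying at infinity such that ∫₀^x y² ν₀(dy) ~ x^{1−ρ} L(x) as x → ∞. Then there is a strictly increasing rescaling λ(t) → ∞ such that lim_{t→∞} M(t, λ(t)x) = M_ρ(x) for all x ∈ [0,∞), where M_ρ is the mass distribution function of the self-similar solution with parameter ρ. -/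

import Mathlib

/-!
Sufficiency part of the scaling theorem for Smoluchowski's coagulation equation
with additive kernel K = x + y: attraction to the self-similar mass distribution M_ρ.
-/

open MeasureTheory Filter Topology Set Real

noncomputable section

/-- The self-similar mass distribution function for the additive kernel, with
β = ρ/(1+ρ):
`M_ρ(x) = Σ_{k=1}^∞ (−1)^{k−1} (x^{kβ}/k!) Γ(1+k−kβ) sin(πkβ)/(πkβ)`. -/
def addSelfSimilarCDF (ρ x : ℝ) : ℝ :=
  ∑' k : ℕ,
    (-1 : ℝ) ^ k * x ^ (((k : ℝ) + 1) * (ρ / (1 + ρ))) / (Nat.factorial (k + 1)) *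
      Real.Gamma (1 + ((k : ℝ) + 1) - ((k : ℝ) + 1) * (ρ / (1 + ρ))) *
      (Real.sin (Real.pi * ((k : ℝ) + 1) * (ρ / (1 + ρ))) /
        (Real.pi * ((k : ℝ) + 1) * (ρ / (1 + ρ))))

/-- The coefficient `binom(j - jβ, j)`. -/
def aC (β : ℝ) (j : ℕ) : ℝ := (∏ l ∈ Finset.range j, ((l:ℝ) + 1 - j * β)) / (Nat.factorial j)

/-- Coefficients of `(1-x)^(-s)`. -/
def bR (s : ℝ) (i : ℕ) : ℝ := (∏ l ∈ Finset.range i, (s + l)) / (Nat.factorial i)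

lemma aC_zero (β : ℝ) : aC β 0 = 1 := by simp [aC]

lemma bR_nonneg {s : ℝ} (hs : 0 ≤ s) (i : ℕ) : 0 ≤ bR s i := by
  unfold bR
  have : 0 ≤ ∏ l ∈ Finset.range i, (s + l) := Finset.prod_nonneg (fun l _ => by positivity)
  positivity

lemma aC_abs_le {β : ℝ} (h0 : 0 ≤ β) (h1 : β ≤ 1) (j : ℕ) : |aC β j| ≤ Real.exp j := by
  have h : |∏ l ∈ Finset.range j, ((l:ℝ) + 1 - j * β)| ≤ (j:ℝ) ^ j := by
    rw [Finset.abs_prod]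
    calc _ ≤ ∏ l ∈ Finset.range j, (j:ℝ) := by
          apply Finset.prod_le_prod
          · intros; positivity
          · intro l hl
            have hl' : (l:ℝ) + 1 ≤ j := by exact_mod_cast Finset.mem_range.1 hl
            have : (0:ℝ) ≤ l := by positivity
            rw [abs_le]
            constructor <;> nlinarith
      _ = _ := by simp
  unfold aC
  rw [abs_div, Nat.abs_cast]
  refine le_trans (div_le_div_of_nonneg_right h (by positivity)) ?_
  exact Real.pow_div_factorial_le_exp (j:ℝ) (by positivity) j

lemma bR_hasSum (s : ℝ) {h : ℝ} (h0 : 0 ≤ h) (h1 : h < 1) :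
    HasSum (fun i => bR s i * h ^ i) ((1 - h) ^ (-s)) := by
  have := (Real.one_div_one_sub_rpow_hasFPowerSeriesOnBall_zero s).hasSum (y := h)
    (by simp [enorm_eq_nnnorm, ← NNReal.coe_lt_coe, abs_of_nonneg h0, h1])
  simp only [zero_add, FormalMultilinearSeries.ofScalars_apply_eq, smul_eq_mul] at this
  rw [Real.rpow_neg (by linarith), ← one_div]
  suffices hs : ∀ i : ℕ, bR s i = Ring.choose (s + i - 1) i by simpa only [hs] using this
  intro i
  have e := Ring.descPochhammer_eq_factorial_smul_choose (s + i - 1) i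
  unfold bR
  rw [div_eq_iff (by positivity), mul_comm, ← nsmul_eq_mul, ← e,
   Polynomial.descPochhammer_smeval_eq_ascPochhammer,
    Polynomial.ascPochhammer_smeval_eq_eval]
  rw [show s + (i:ℝ) - 1 - i + 1 = s by ring]
  clear e
  induction i with
  | zero => simp
  | succ i ih => rw [Finset.prod_range_succ, ih, ascPochhammer_succ_eval]

lemma aC_bR (β : ℝ) (n j i : ℕ) (hij : j + i = n + 1) :
    aC β j * bR ((1 - β) * j) i = ((n+1).choose j : ℝ) / (Nat.factorial (n+1)) *
      ((1 - β) * j * ∏ l ∈ Finset.range n, ((l:ℝ) + 1 - β * j)) := by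
  have hch : ((n+1).choose j : ℝ) / (Nat.factorial (n+1)) = 1 / (Nat.factorial j * Nat.factorial i) := by
    rw [← hij, div_eq_div_iff (by positivity) (by positivity), one_mul]
    have := Nat.choose_mul_factorial_mul_factorial (Nat.le_add_right j i)
    rw [Nat.add_sub_cancel_left] at this
    rw [← this]
    push_cast
    ring
  rw [hch]
  unfold aC bR
  rw [div_mul_div_comm, div_eq_mul_one_div, mul_comm]
  congr 1
  rcases Nat.eq_zero_or_pos i with hi | hi
  · subst hi
    have : j = n + 1 := by omega
    subst this
    rw [Finset.prod_range_succ]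
    push_cast
    simp only [Finset.range_zero, Finset.prod_empty, mul_one]
    rw [show ((n:ℝ) + 1 - (n+1) * β) = (1-β) * (n+1) by ring, mul_comm]
    congr 1
    apply Finset.prod_congr rfl
    intros; ring
  · obtain ⟨i, rfl⟩ : ∃ i', i = i' + 1 := ⟨i - 1, by omega⟩
    have : n = j + i := by omega
    subst this
    rw [Finset.prod_range_succ' _ i, Finset.prod_range_add _ j i]
    push_cast
    rw [show (∏ l ∈ Finset.range j, ((l:ℝ) + 1 - j * β)) = ∏ l ∈ Finset.range j, ((l:ℝ) + 1 - β * j) by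
      apply Finset.prod_congr rfl; intros; ring]
    rw [show (∏ l ∈ Finset.range i, ((1 - β) * (j:ℝ) + ((l:ℝ) + 1))) = ∏ x ∈ Finset.range i, ((j:ℝ) + x + 1 - β * j) by
      apply Finset.prod_congr rfl; intros; ring]
    ring

lemma alt_sum {β : ℝ} (hβ : β ≠ 0) (hβ1 : β ≠ 1) (n : ℕ) :
    ∑ j ∈ Finset.range (n + 2), (-1:ℝ) ^ j * ((n+1).choose j : ℝ) *
      ((1 - β) * j * ∏ l ∈ Finset.range n, ((l:ℝ) + 1 - β * j)) =
      - (Nat.factorial (n+1)) * (1 - β) * β ^ n := by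
  let Q : Polynomial ℝ := ∏ l ∈ Finset.range n, (Polynomial.C (-β) * Polynomial.X + Polynomial.C ((l:ℝ) + 1))
  let P : Polynomial ℝ := Polynomial.C (1 - β) * Polynomial.X * Q
  have hne : ∀ l : ℕ, (Polynomial.C (-β) * Polynomial.X + Polynomial.C ((l:ℝ) + 1)) ≠ 0 := by
    intro l h
    have := congrArg Polynomial.natDegree h
    rw [Polynomial.natDegree_linear (neg_ne_zero.2 hβ)] at this
    simp at this
  have hQ0 : Q ≠ 0 := Finset.prod_ne_zero_iff.2 (fun l _ => hne l)
  have hdeg : P.natDegree = n + 1 := by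
    rw [Polynomial.natDegree_mul (mul_ne_zero (Polynomial.C_ne_zero.2 (sub_ne_zero.2 hβ1.symm)) Polynomial.X_ne_zero) hQ0,
      Polynomial.natDegree_C_mul_X _ (by simpa [sub_eq_zero] using hβ1.symm),
      Polynomial.natDegree_prod _ _ (fun l _ => hne l)]
    simp only [Polynomial.natDegree_linear (neg_ne_zero.2 hβ)]
    simp [add_comm]
  have hlead : P.leadingCoeff = (1 - β) * (-β) ^ n := by
    rw [Polynomial.leadingCoeff_mul, Polynomial.leadingCoeff_prod, Polynomial.leadingCoeff_mul,
      Polynomial.leadingCoeff_C, Polynomial.leadingCoeff_X]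
    simp only [Polynomial.leadingCoeff_linear (neg_ne_zero.2 hβ)]
    simp
  have key := congrFun (Polynomial.fwdDiff_iter_degree_eq_factorial P) 0
  rw [hdeg, hlead, fwdDiff_iter_eq_sum_shift] at key
  have heval : ∀ x : ℝ, P.eval x = (1 - β) * x * ∏ l ∈ Finset.range n, ((l:ℝ) + 1 - β * x) := by
    intro x
    simp only [P, Q, Polynomial.eval_mul, Polynomial.eval_prod, Polynomial.eval_add,
      Polynomial.eval_C, Polynomial.eval_X]
    congr 1
    apply Finset.prod_congr rfl
    intros; ring
  simp only [zero_add, nsmul_eq_mul, mul_one, zsmul_eq_mul, heval] at key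
  have h2 : ∀ j ∈ Finset.range (n+2), (-1:ℝ) ^ j * ((n+1).choose j : ℝ) *
      ((1 - β) * j * ∏ l ∈ Finset.range n, ((l:ℝ) + 1 - β * j)) = (-1) ^ (n+1) *
      (((-1 : ℤ) ^ (n + 1 - j) * ((n+1).choose j : ℤ) : ℤ) *
      ((1 - β) * j * ∏ l ∈ Finset.range n, ((l:ℝ) + 1 - β * j))) := by
    intro j hj
    have hj' : j ≤ n + 1 := by have := Finset.mem_range.1 hj; omega
    obtain ⟨i, hi⟩ := Nat.exists_eq_add_of_le hj'
    rw [hi, Nat.add_sub_cancel_left]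
    push_cast
    have : (-1:ℝ) ^ (j + i) * (-1) ^ i = (-1) ^ j := by
      rw [pow_add, mul_assoc, ← mul_pow]; simp
    rw [← this]; ring
  rw [Finset.sum_congr rfl h2, ← Finset.mul_sum, key]
  simp only [Pi.smul_apply, smul_eq_mul, Pi.natCast_apply]
  rw [show (-β) ^ n = (-1) ^ n * β ^ n by rw [← mul_pow]; simp]
  have : (-1:ℝ) ^ (n + 1) * (-1) ^ n = -1 := by
    rw [pow_succ, mul_right_comm, ← mul_pow]; simp
  linear_combination ((1 - β) * β ^ n * (Nat.factorial (n+1))) * this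

lemma antidiag_sum {β : ℝ} (hβ : β ≠ 0) (hβ1 : β ≠ 1) (n : ℕ) :
    ∑ x ∈ Finset.HasAntidiagonal.antidiagonal (n+1), (-1:ℝ) ^ x.1 * aC β x.1 * bR ((1 - β) * x.1) x.2 =
      - (1 - β) * β ^ n := by
  rw [Finset.Nat.sum_antidiagonal_eq_sum_range_succ_mk]
  have : ∀ j ∈ Finset.range (n+1).succ, (-1:ℝ) ^ j * aC β j * bR ((1 - β) * j) (n + 1 - j)
      = ((-1:ℝ) ^ j * ((n+1).choose j : ℝ) *
      ((1 - β) * j * ∏ l ∈ Finset.range n, ((l:ℝ) + 1 - β * j))) / (Nat.factorial (n+1)) := by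
    intro j hj
    rw [mul_assoc, aC_bR β n j _ (by have := Finset.mem_range.1 hj; omega)]
    ring
  simp only []
  rw [Finset.sum_congr rfl this, ← Finset.sum_div, alt_sum hβ hβ1]
  field_simp

lemma hs_congr {f g : ℕ → ℝ} {a b : ℝ} (hg : HasSum g b) (h : ∀ i, f i = g i) (hab : a = b) :
    HasSum f a := by
  rw [hab, funext h]; exact hg

lemma lag_bound {β h : ℝ} (hβ0 : 0 < β) (hβ1 : β < 1) (h0 : 0 ≤ h) (h1 : h ≤ 1/4) :
    0 ≤ h * (1 - h) ^ (-(1-β)) ∧ h * (1 - h) ^ (-(1-β)) ≤ 1/3 := by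
  have hp : (0:ℝ) < 1 - h := by linarith
  have h2 : (1 - h) ^ (-(1-β)) ≤ 4/3 := by
    calc (1 - h) ^ (-(1-β)) ≤ (1 - h) ^ (-1:ℝ) := by
          apply Real.rpow_le_rpow_of_exponent_ge hp <;> linarith
      _ = (1-h)⁻¹ := Real.rpow_neg_one _
      _ ≤ 4/3 := by
          rw [inv_le_comm₀ hp (by norm_num)]; norm_num; linarith
  have h3 : 0 ≤ (1 - h) ^ (-(1-β)) := by positivity
  exact ⟨by positivity, by nlinarith⟩

lemma aC_summable {β w : ℝ} (hβ0 : 0 < β) (hβ1 : β < 1) (h0 : 0 ≤ w) (h1 : w ≤ 1/3) :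
    Summable (fun j => |aC β j| * w ^ j) := by
  have hg : Summable (fun j : ℕ => (Real.exp 1 * w) ^ j) := by
    apply summable_geometric_of_lt_one (by positivity)
    have := Real.exp_one_lt_d9
    nlinarith [Real.exp_pos 1]
  refine Summable.of_nonneg_of_le (fun j => by positivity) (fun j => ?_) hg
  rw [mul_pow, ← Real.exp_nat_mul, mul_one]
  exact mul_le_mul_of_nonneg_right (aC_abs_le hβ0.le hβ1.le j) (by positivity)

lemma lagrange {β h : ℝ} (hβ0 : 0 < β) (hβ1 : β < 1) (h0 : 0 ≤ h) (h1 : h ≤ 1/4) :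
    HasSum (fun j => (-1:ℝ) ^ j * aC β j * (h * (1 - h) ^ (-(1-β))) ^ j)
      ((1 - h) / (1 - β * h)) := by
  have hp : (0:ℝ) < 1 - h := by linarith
  set w := h * (1 - h) ^ (-(1-β)) with hw
  obtain ⟨hw0, hw1⟩ := lag_bound hβ0 hβ1 h0 h1
  rw [← hw] at hw0 hw1
  let F : ℕ × ℕ → ℝ := fun x => (-1:ℝ) ^ x.1 * aC β x.1 * h ^ x.1 * (bR ((1-β) * x.1) x.2 * h ^ x.2)
  have hpw : ∀ j : ℕ, h ^ j * (1 - h) ^ (-((1-β) * j)) = w ^ j := by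
    intro j
    rw [hw, mul_pow, ← Real.rpow_mul_natCast hp.le]
    congr 2; ring
  have hrow : ∀ j : ℕ, HasSum (fun i => F (j, i)) ((-1:ℝ) ^ j * aC β j * w ^ j) := by
    intro j
    have := (bR_hasSum ((1-β) * j) h0 (by linarith)).mul_left ((-1:ℝ) ^ j * aC β j * h ^ j)
    rw [mul_assoc _ (h ^ j), hpw] at this
    exact this
  have hrown : ∀ j : ℕ, HasSum (fun i => ‖F (j, i)‖) (|aC β j| * w ^ j) := by
    intro j
    have := (bR_hasSum ((1-β) * j) h0 (by linarith)).mul_left (|aC β j| * h ^ j)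
    rw [mul_assoc _ (h ^ j), hpw] at this
    refine hs_congr this (fun i => ?_) rfl
    have hb : 0 ≤ bR ((1-β) * j) i := bR_nonneg (by have : 0 ≤ 1 - β := by linarith
                                                    positivity) i
    simp only [F, norm_mul, norm_pow, norm_neg, norm_one, one_pow, one_mul, Real.norm_eq_abs,
      abs_of_nonneg h0, abs_of_nonneg hb]
  have hsum : Summable F := by
    apply Summable.of_norm
    rw [summable_prod_of_nonneg (fun _ => norm_nonneg _)]
    refine ⟨fun j => (hrown j).summable, ?_⟩
    simp only [(hrown _).tsum_eq]
    exact aC_summable hβ0 hβ1 hw0 hw1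
  have hA : HasSum (fun n : ℕ => ∑ x ∈ Finset.HasAntidiagonal.antidiagonal n, F x) (∑' x, F x) := by
    have h3 := (Finset.HasAntidiagonal.sigmaAntidiagonalEquivProd (A := ℕ)).hasSum_iff.2 hsum.hasSum
    have h4 := h3.sigma (fun n => hasSum_fintype _)
    refine hs_congr h4 (fun n => ?_) rfl
    rw [← Finset.sum_coe_sort]
    rfl
  have hB : HasSum (fun n : ℕ => ∑ x ∈ Finset.HasAntidiagonal.antidiagonal n, F x)
      ((1 - h) / (1 - β * h)) := by
    have hbh : β * h < 1 := by nlinarith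
    rw [← hasSum_nat_add_iff' 1]
    have hg := (hasSum_geometric_of_lt_one (r := β * h) (by positivity) hbh).mul_left (-(1-β) * h)
    refine hs_congr hg (fun n => ?_) ?_
    · have hh : ∀ x ∈ Finset.HasAntidiagonal.antidiagonal ((n:ℕ)+1), F x
          = ((-1:ℝ) ^ x.1 * aC β x.1 * bR ((1 - β) * x.1) x.2) * h ^ (n+1) := by
        intro x hx
        rw [← Finset.HasAntidiagonal.mem_antidiagonal.1 hx, pow_add]
        simp only [F]; ring
      rw [Finset.sum_congr rfl hh, ← Finset.sum_mul, antidiag_sum hβ0.ne' hβ1.ne]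
      ring
    · have : F (0,0) = 1 := by simp [F, aC, bR]
      have hne : 1 - β * h ≠ 0 := by intro h; linarith
      have hs : ∑ i ∈ Finset.range 1, ∑ x ∈ Finset.HasAntidiagonal.antidiagonal i, F x = 1 := by
        simp [this]
      rw [hs, div_eq_mul_inv]
      have hinv := mul_inv_cancel₀ hne
      linear_combination hinv
  have := (hsum.hasSum).prod_fiberwise hrow
  rwa [hA.unique hB] at this

lemma integrable_tsum_aux {α : Type*} [MeasurableSpace α] {μ : Measure α} {F : ℕ → α → ℝ}
    (hF : ∀ i, Integrable (F i) μ) (hs : Summable fun i => ∫ a, ‖F i a‖ ∂μ) :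
    Integrable (fun a => ∑' i, F i a) μ := by
  have hfin : ∑' i, ∫⁻ a, ‖F i a‖ₑ ∂μ ≠ ⊤ := by
    have : ∀ i, ∫⁻ a, ‖F i a‖ₑ ∂μ = ENNReal.ofReal (∫ a, ‖F i a‖ ∂μ) := by
      intro i
      rw [ofReal_integral_norm_eq_lintegral_enorm (hF i)]
    simp only [this]
    exact hs.tsum_ofReal_ne_top
  have hfin' : ∫⁻ a, ∑' i, ‖F i a‖ₑ ∂μ ≠ ⊤ := by
    rwa [lintegral_tsum (fun i => (hF i).1.enorm)]
  have hae : ∀ᵐ a ∂μ, Summable (fun i => F i a) := by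
    have := ae_lt_top' (AEMeasurable.ennreal_tsum (fun i => (hF i).1.enorm)) hfin'
    filter_upwards [this] with a ha
    exact Summable.of_enorm ha.ne
  refine ⟨?_, ?_⟩
  · refine aestronglyMeasurable_of_tendsto_ae atTop (f := fun n a => ∑ i ∈ Finset.range n, F i a) ?_ ?_
    · intro n
      have := Finset.aestronglyMeasurable_fun_sum (Finset.range n) (f := F) (fun i _ => (hF i).1)
      exact this
    · filter_upwards [hae] with a ha
      exact ha.hasSum.tendsto_sum_nat
  · refine lt_of_le_of_lt (lintegral_mono (fun a => ?_)) (lt_top_iff_ne_top.2 hfin')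
    exact enorm_tsum_le_tsum_enorm

/-- Coefficients of the self-similar mass distribution. -/
def cS (β : ℝ) (k : ℕ) : ℝ :=
  (-1 : ℝ) ^ k / (Nat.factorial (k + 1)) *
      Real.Gamma (1 + ((k : ℝ) + 1) - ((k : ℝ) + 1) * β) *
      (Real.sin (Real.pi * ((k : ℝ) + 1) * β) / (Real.pi * ((k : ℝ) + 1) * β))

lemma cdf_eq (ρ x : ℝ) : addSelfSimilarCDF ρ x =
    ∑' k : ℕ, cS (ρ / (1 + ρ)) k * x ^ (((k : ℝ) + 1) * (ρ / (1 + ρ))) := by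
  unfold addSelfSimilarCDF cS
  congr 1
  ext k
  ring

lemma Gamma_shift (s : ℝ) (hs : ∀ l : ℕ, s + l ≠ 0) (j : ℕ) :
    Real.Gamma (s + j) = (∏ l ∈ Finset.range j, (s + l)) * Real.Gamma s := by
  induction j with
  | zero => simp
  | succ j ih =>
    rw [Finset.prod_range_succ]
    push_cast
    rw [← add_assoc, Real.Gamma_add_one (hs j), ih]
    ring

lemma cS_mul_Gamma {β : ℝ} (hβ0 : 0 < β) (hβ1 : β < 1) (k : ℕ) :
    cS β k * Real.Gamma (((k:ℝ) + 1) * β + 1) = (-1:ℝ) ^ k * aC β (k+1) := by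
  set y : ℝ := ((k:ℝ) + 1) * β with hy
  have hy0 : 0 < y := by positivity
  have hpi := Real.pi_pos
  by_cases hsin : Real.sin (Real.pi * y) = 0
  · have h1 : cS β k = 0 := by
      unfold cS
      rw [show Real.pi * ((k:ℝ)+1) * β = Real.pi * y by rw [hy]; ring, hsin]
      simp
    rw [h1, zero_mul]
    obtain ⟨n, hn⟩ := Real.sin_eq_zero_iff.1 hsin
    have hny : (n:ℝ) = y := by
      rw [mul_comm] at hn
      exact mul_left_cancel₀ hpi.ne' hn
    have hn0 : 0 < n := by
      have : (0:ℝ) < n := by rw [hny]; exact hy0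
      exact_mod_cast this
    have hnk : n < (k:ℤ) + 1 := by
      have : (n:ℝ) < (k:ℝ) + 1 := by rw [hny, hy]; nlinarith
      exact_mod_cast this
    have h2 : aC β (k+1) = 0 := by
      unfold aC
      rw [Finset.prod_eq_zero (i := (n-1).toNat)]
      · simp
      · rw [Finset.mem_range]; omega
      · have h3 : (((n-1).toNat : ℤ) : ℝ) = ((n - 1 : ℤ) : ℝ) := by
          rw [Int.toNat_of_nonneg (by omega)]
        have h4 : (((n-1).toNat : ℕ) : ℝ) = (n:ℝ) - 1 := by
          push_cast at h3
          exact_mod_cast h3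
        rw [h4, hny, hy]
        push_cast; ring
    rw [h2, mul_zero]
  · have hIntg : ∀ l : ℕ, (1 - y) + l ≠ 0 := by
      intro l h
      apply hsin
      have : Real.pi * y = ((l + 1 : ℕ) : ℝ) * Real.pi := by
        push_cast
        rw [show y = 1 + l by linarith]; ring
      rw [this]
      exact Real.sin_nat_mul_pi _
    have hG := Gamma_shift (1 - y) hIntg (k+1)
    have hrefl := Real.Gamma_mul_Gamma_one_sub y
    have hG1 : Real.Gamma (y + 1) = y * Real.Gamma y := Real.Gamma_add_one hy0.ne'
    unfold cS aC
    rw [show Real.pi * ((k:ℝ)+1) * β = Real.pi * y by rw [hy]; ring, hG1,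
      show 1 + ((k:ℝ) + 1) - y = (1 - y) + ((k+1 : ℕ):ℝ) by push_cast; ring, hG]
    have hprod : ∏ l ∈ Finset.range (k+1), ((1 - y) + l) =
        ∏ l ∈ Finset.range (k+1), ((l:ℝ) + 1 - ((k+1:ℕ):ℝ) * β) := by
      apply Finset.prod_congr rfl
      intro l _
      rw [hy]; push_cast; ring
    rw [hprod]
    set Pr := ∏ l ∈ Finset.range (k+1), ((l:ℝ) + 1 - ((k+1:ℕ):ℝ) * β)
    have h5 : Real.Gamma y * Real.Gamma (1 - y) * (Real.sin (Real.pi * y) / Real.pi) = 1 := by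
      rw [hrefl]; field_simp
    have h6 : Real.sin (Real.pi * y) / (Real.pi * y) * y = Real.sin (Real.pi * y) / Real.pi := by
      field_simp
    calc _ = (-1:ℝ) ^ k / (Nat.factorial (k + 1)) * Pr * (Real.Gamma y * Real.Gamma (1 - y) *
          (Real.sin (Real.pi * y) / (Real.pi * y) * y)) := by ring
      _ = _ := by rw [h6, h5]; ring

/-- Terms of the density. -/
def mF (β : ℝ) (k : ℕ) (x : ℝ) : ℝ := cS β k * (((k:ℝ)+1) * β) * x ^ (((k:ℝ)+1) * β - 1)

/-- The self-similar mass density. -/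
def mD (β x : ℝ) : ℝ := ∑' k, mF β k x

lemma mF_int {β p : ℝ} (hβ0 : 0 < β) (hβ1 : β < 1) (hp : 0 < p) (k : ℕ) :
    IntegrableOn (fun x => Real.exp (-(p * x)) * mF β k x) (Ioi 0) ∧
    ∫ x in Ioi 0, Real.exp (-(p * x)) * mF β k x = (-1:ℝ) ^ k * aC β (k+1) * (p ^ (-β)) ^ (k+1) ∧
    ∫ x in Ioi 0, ‖Real.exp (-(p * x)) * mF β k x‖ = |aC β (k+1)| * (p ^ (-β)) ^ (k+1) := by
  set y : ℝ := ((k:ℝ) + 1) * β with hy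
  have hy0 : 0 < y := by positivity
  have hi : IntegrableOn (fun x => x ^ (y - 1) * Real.exp (-(p * x))) (Ioi 0) := by
    have := integrableOn_rpow_mul_exp_neg_mul_rpow (p := 1) (s := y - 1) (b := p) (by linarith) one_pos hp
    simpa [neg_mul] using this
  have hpw : (1 / p) ^ y = (p ^ (-β)) ^ (k+1) := by
    rw [one_div, Real.inv_rpow hp.le, ← Real.rpow_neg hp.le, ← Real.rpow_mul_natCast hp.le, hy]
    congr 1; push_cast; ring
  have hval : ∫ x in Ioi 0, x ^ (y - 1) * Real.exp (-(p * x)) = (p ^ (-β)) ^ (k+1) * Real.Gamma y := by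
    rw [Real.integral_rpow_mul_exp_neg_mul_Ioi hy0 hp, hpw]
  have hform : ∀ x, Real.exp (-(p * x)) * mF β k x = cS β k * y * (x ^ (y-1) * Real.exp (-(p * x))) := by
    intro x; unfold mF; rw [← hy]; ring
  have hc : cS β k * y * Real.Gamma y = (-1:ℝ) ^ k * aC β (k+1) := by
    rw [← cS_mul_Gamma hβ0 hβ1, ← hy, Real.Gamma_add_one hy0.ne']; ring
  simp only [hform]
  refine ⟨hi.const_mul _, ?_, ?_⟩
  · rw [integral_const_mul, hval, ← hc]; ring
  · have : ∀ x ∈ Ioi (0:ℝ), ‖cS β k * y * (x ^ (y-1) * Real.exp (-(p * x)))‖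
        = |cS β k * y| * (x ^ (y-1) * Real.exp (-(p * x))) := by
      intro x hx
      have hx : 0 < x := hx
      rw [norm_mul, Real.norm_eq_abs, Real.norm_of_nonneg]
      positivity
    rw [setIntegral_congr_fun measurableSet_Ioi this, integral_const_mul, hval]
    have hG := Real.Gamma_pos_of_pos hy0
    have : |cS β k * y| * Real.Gamma y = |aC β (k+1)| := by
      have e := congrArg abs hc
      rw [abs_mul, abs_of_pos hG] at e
      rw [e, abs_mul, abs_pow]; simp
    rw [← this]; ring

lemma mD_laplace {β p : ℝ} (hβ0 : 0 < β) (hβ1 : β < 1) (hp : 0 < p) (hp3 : p ^ (-β) ≤ 1/3) :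
    IntegrableOn (fun x => Real.exp (-(p * x)) * mD β x) (Ioi 0) ∧
    HasSum (fun k => (-1:ℝ) ^ k * aC β (k+1) * (p ^ (-β)) ^ (k+1))
      (∫ x in Ioi 0, Real.exp (-(p * x)) * mD β x) := by
  have hs : Summable fun k => ∫ x in Ioi 0, ‖Real.exp (-(p * x)) * mF β k x‖ := by
    simp only [fun k => (mF_int hβ0 hβ1 hp k).2.2]
    exact (summable_nat_add_iff 1).2 (aC_summable hβ0 hβ1 (by positivity) hp3)
  have h1 := integrable_tsum_aux (fun k => (mF_int hβ0 hβ1 hp k).1) hs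
  have h2 := hasSum_integral_of_summable_integral_norm (fun k => (mF_int hβ0 hβ1 hp k).1) hs
  simp only [fun k => (mF_int hβ0 hβ1 hp k).2.1] at h2
  simp only [tsum_mul_left] at h1 h2
  exact ⟨h1, h2⟩

lemma mD_cdf {β p x : ℝ} (hβ0 : 0 < β) (hβ1 : β < 1) (hp : 0 < p) (hp3 : p ^ (-β) ≤ 1/3)
    (hx : 0 < x) :
    ∫ y in Ioc 0 x, mD β y = ∑' k, cS β k * x ^ (((k:ℝ)+1) * β) := by
  have hs : Summable fun k => ∫ x in Ioi 0, ‖Real.exp (-(p * x)) * mF β k x‖ := by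
    simp only [fun k => (mF_int hβ0 hβ1 hp k).2.2]
    exact (summable_nat_add_iff 1).2 (aC_summable hβ0 hβ1 (by positivity) hp3)
  have hIntg : ∀ k, IntegrableOn (mF β k) (Ioc 0 x) := by
    intro k
    have hy0 : 0 < ((k:ℝ)+1) * β := by positivity
    have := (intervalIntegral.intervalIntegrable_rpow' (a := 0) (b := x)
      (r := ((k:ℝ)+1) * β - 1) (by linarith)).1
    exact this.const_mul _
  have hval : ∀ k, ∫ y in Ioc 0 x, mF β k y = cS β k * x ^ (((k:ℝ)+1) * β) := by
    intro k
    have hy0 : 0 < ((k:ℝ)+1) * β := by positivity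
    unfold mF
    rw [integral_const_mul, ← intervalIntegral.integral_of_le hx.le, integral_rpow (Or.inl (by linarith))]
    rw [sub_add_cancel, Real.zero_rpow hy0.ne', sub_zero]
    field_simp
  have hs2 : Summable fun k => ∫ y in Ioc 0 x, ‖mF β k y‖ := by
    refine Summable.of_nonneg_of_le (fun k => integral_nonneg (fun _ => norm_nonneg _)) (fun k => ?_)
      (hs.mul_left (Real.exp (p * x)))
    rw [← integral_const_mul]
    have hI := ((mF_int hβ0 hβ1 hp k).1.norm).const_mul (Real.exp (p * x))
    calc ∫ y in Ioc 0 x, ‖mF β k y‖ ≤ ∫ y in Ioc 0 x, Real.exp (p * x) * ‖Real.exp (-(p * y)) * mF β k y‖ := by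
          apply setIntegral_mono_on (hIntg k).norm (hI.mono_measure (Measure.restrict_mono Ioc_subset_Ioi_self le_rfl)) measurableSet_Ioc
          intro y hy
          rw [norm_mul, ← mul_assoc, Real.norm_of_nonneg (Real.exp_pos _).le, ← Real.exp_add]
          apply le_mul_of_one_le_left (norm_nonneg _)
          apply Real.one_le_exp
          nlinarith [hy.2]
      _ ≤ _ := by
          apply setIntegral_mono_set hI
          · exact ae_of_all _ (fun y => by positivity)
          · exact Ioc_subset_Ioi_self.eventuallyLE
  have h2 := hasSum_integral_of_summable_integral_norm hIntg hs2
  simp only [hval] at h2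
  exact h2.tsum_eq.symm

/-- The Laplace transform of the density, in parametrized form. -/
lemma mD_laplace_eq {ρ a : ℝ} (hρ : 0 < ρ) (ha : 0 < a) (ha3 : 3 ≤ a ^ ρ) :
    (a + a ^ (1 + ρ)) ^ (-(ρ / (1 + ρ))) ≤ 1/3 ∧
    IntegrableOn (fun x => Real.exp (-((a + a ^ (1 + ρ)) * x)) * mD (ρ / (1 + ρ)) x) (Ioi 0) ∧
    ∫ x in Ioi 0, Real.exp (-((a + a ^ (1 + ρ)) * x)) * mD (ρ / (1 + ρ)) x
      = 1 / (1 + (1 + ρ) * a ^ ρ) := by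
  set β := ρ / (1 + ρ) with hβ
  have hβ0 : 0 < β := by positivity
  have hβ1 : β < 1 := by rw [hβ, div_lt_one (by positivity)]; linarith
  set A := a ^ ρ with hA
  have hA0 : 0 < A := by positivity
  have hP : a + a ^ (1 + ρ) = a * (1 + A) := by
    rw [Real.rpow_add ha, Real.rpow_one]; ring
  set p := a + a ^ (1 + ρ) with hp
  have hp0 : 0 < p := by positivity
  set h := 1 / (1 + A) with hh
  have h0 : 0 ≤ h := by positivity
  have h1 : h ≤ 1/4 := by
    rw [hh]; apply one_div_le_one_div_of_le <;> linarith
  have hw : h * (1 - h) ^ (-(1-β)) = p ^ (-β) := by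
    have e1 : 1 - h = A / (1 + A) := by rw [hh]; field_simp; ring
    have e2 : 1 - β = 1 / (1 + ρ) := by rw [hβ]; field_simp; ring
    have hl : (0:ℝ) < 1 + A := by positivity
    rw [e1, hP, Real.div_rpow hA0.le hl.le, Real.mul_rpow ha.le hl.le]
    have e3 : A ^ (-(1 - β)) = a ^ (-β) := by
      rw [hA, ← Real.rpow_mul ha.le, e2, hβ]
      congr 1; field_simp
    rw [e3, hh]
    have e4 : (1 + A) ^ (-β) = (1 + A) ^ (-1:ℝ) * ((1 + A) ^ (-(1-β)))⁻¹ := by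
      rw [← Real.rpow_neg hl.le, ← Real.rpow_add hl]; congr 1; ring
    rw [e4, Real.rpow_neg_one]
    field_simp
  obtain ⟨hb0, hb1⟩ := lag_bound hβ0 hβ1 h0 h1
  have hlag := lagrange hβ0 hβ1 h0 h1
  rw [hw] at hb1 hlag
  obtain ⟨hI, hS⟩ := mD_laplace hβ0 hβ1 hp0 hb1
  refine ⟨hb1, hI, ?_⟩
  rw [← hasSum_nat_add_iff' 1] at hlag
  have hS' := hs_congr (hlag.mul_left (-1)) (f := fun k => (-1:ℝ) ^ k * aC β (k+1) * (p ^ (-β)) ^ (k+1))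
    (fun k => by rw [pow_succ (-1:ℝ)]; ring) rfl
  rw [hS.unique hS']
  simp only [Finset.range_one, Finset.sum_singleton, pow_zero, aC_zero, mul_one]
  have e5 : 1 - β * h ≠ 0 := by
    have : β * h < 1 := by nlinarith
    intro h; linarith
  have e6 : (1 - h) / (1 - β * h) = (1 + ρ) * A / (1 + (1 + ρ) * A) := by
    rw [div_eq_div_iff e5 (by positivity), hh, hβ]
    field_simp
    ring
  rw [e6]
  field_simp
  ring

section cont
variable {ι : Type*} {l : Filter ι} {μ : ι → Measure ℝ} {m : ℝ → ℝ} {p₀ : ℝ}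

lemma int_bdd {μ : Measure ℝ} (h0 : μ (Iic 0) = 0) {f : ℝ → ℝ} (hf : Integrable f μ)
    {G : ℝ → ℝ} (hG : Continuous G) :
    Integrable (fun x => f x * G (Real.exp (-x))) μ := by
  obtain ⟨C, hC⟩ := (isCompact_Icc (a := (0:ℝ)) (b := 1)).exists_bound_of_continuousOn hG.continuousOn
  refine hf.mul_bdd (c := C) (by fun_prop) ?_
  have : ∀ᵐ x ∂μ, x ∉ Iic 0 := measure_eq_zero_iff_ae_notMem.1 h0
  filter_upwards [this] with x hx
  have hx : 0 < x := not_le.1 hx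
  exact hC _ ⟨(Real.exp_pos _).le, by simpa using hx.le⟩

lemma int_err {μ : Measure ℝ} (h0 : μ (Iic 0) = 0) {f : ℝ → ℝ} (hf : Integrable f μ)
    {G Q : ℝ → ℝ} (hG : Continuous G) (hQ : Continuous Q) {ε : ℝ}
    (h : ∀ u ∈ Icc (0:ℝ) 1, |Q u - G u| ≤ ε) :
    |∫ x, f x * Q (Real.exp (-x)) ∂μ - ∫ x, f x * G (Real.exp (-x)) ∂μ| ≤ ε * ∫ x, |f x| ∂μ := by
  rw [← integral_sub (int_bdd h0 hf hQ) (int_bdd h0 hf hG), ← integral_const_mul, ← Real.norm_eq_abs]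
  refine norm_integral_le_of_norm_le (hf.abs.const_mul _) ?_
  have : ∀ᵐ x ∂μ, x ∉ Iic 0 := measure_eq_zero_iff_ae_notMem.1 h0
  filter_upwards [this] with x hx
  have hx : 0 < x := not_le.1 hx
  have := h (Real.exp (-x)) ⟨(Real.exp_pos _).le, by simpa using hx.le⟩
  rw [← mul_sub, norm_mul, Real.norm_eq_abs, Real.norm_eq_abs, mul_comm]
  exact mul_le_mul_of_nonneg_right this (abs_nonneg _)

lemma vol0 : (volume.restrict (Ioi (0:ℝ))) (Iic 0) = 0 := by
  rw [Measure.restrict_apply measurableSet_Iic]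
  have : Iic (0:ℝ) ∩ Ioi 0 = ∅ := by ext x; simp
  simp [this]

lemma poly_lim (h0 : ∀ᶠ t in l, μ t (Iic 0) = 0)
    (hi : ∀ᶠ t in l, Integrable (fun x => Real.exp (-(p₀ * x))) (μ t))
    (hm : IntegrableOn (fun x => Real.exp (-(p₀ * x)) * m x) (Ioi 0))
    (hL : ∀ n : ℕ, Tendsto (fun t => ∫ x, Real.exp (-((p₀ + n) * x)) ∂(μ t)) l
      (𝓝 (∫ x in Ioi 0, Real.exp (-((p₀ + n) * x)) * m x))) (Q : Polynomial ℝ) :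
    Tendsto (fun t => ∫ x, Real.exp (-(p₀ * x)) * Q.eval (Real.exp (-x)) ∂(μ t)) l
      (𝓝 (∫ x in Ioi 0, (Real.exp (-(p₀ * x)) * m x) * Q.eval (Real.exp (-x)))) := by
  induction Q using Polynomial.induction_on' with
  | add p q hp hq =>
    have e : (∫ x in Ioi 0, (Real.exp (-(p₀ * x)) * m x) * (p+q).eval (Real.exp (-x)))
      = (∫ x in Ioi 0, (Real.exp (-(p₀ * x)) * m x) * p.eval (Real.exp (-x))) +
        (∫ x in Ioi 0, (Real.exp (-(p₀ * x)) * m x) * q.eval (Real.exp (-x))) := by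
      rw [← integral_add (int_bdd vol0 hm p.continuous) (int_bdd vol0 hm q.continuous)]
      simp only [Polynomial.eval_add, mul_add]
    rw [e]
    refine (hp.add hq).congr' ?_
    filter_upwards [h0, hi] with t h0 hi
    rw [← integral_add (int_bdd h0 hi p.continuous) (int_bdd h0 hi q.continuous)]
    simp only [Polynomial.eval_add, mul_add]
  | monomial n a =>
    have key : ∀ x, Real.exp (-(p₀*x)) * (Polynomial.monomial n a).eval (Real.exp (-x))
        = a * Real.exp (-((p₀ + n) * x)) := by
      intro x
      rw [Polynomial.eval_monomial, ← Real.exp_nat_mul, mul_left_comm, ← Real.exp_add]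
      congr 2; ring
    have key2 : ∀ x, (Real.exp (-(p₀*x)) * m x) * (Polynomial.monomial n a).eval (Real.exp (-x))
        = a * (Real.exp (-((p₀ + n) * x)) * m x) := by
      intro x
      rw [mul_right_comm, key]; ring
    simp only [key, key2, integral_const_mul]
    exact (hL n).const_mul a

lemma cont_lim (h0 : ∀ᶠ t in l, μ t (Iic 0) = 0)
    (hi : ∀ᶠ t in l, Integrable (fun x => Real.exp (-(p₀ * x))) (μ t))
    (hm : IntegrableOn (fun x => Real.exp (-(p₀ * x)) * m x) (Ioi 0))
    (hL : ∀ n : ℕ, Tendsto (fun t => ∫ x, Real.exp (-((p₀ + n) * x)) ∂(μ t)) l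
      (𝓝 (∫ x in Ioi 0, Real.exp (-((p₀ + n) * x)) * m x))) {G : ℝ → ℝ} (hG : Continuous G) :
    Tendsto (fun t => ∫ x, Real.exp (-(p₀ * x)) * G (Real.exp (-x)) ∂(μ t)) l
      (𝓝 (∫ x in Ioi 0, (Real.exp (-(p₀ * x)) * m x) * G (Real.exp (-x)))) := by
  rw [Metric.tendsto_nhds]
  intro e he
  set A := |∫ x in Ioi 0, Real.exp (-((p₀ + (0:ℕ)) * x)) * m x| + 1 with hA
  set B := ∫ x in Ioi 0, |Real.exp (-(p₀ * x)) * m x| with hB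
  have hB0 : 0 ≤ B := integral_nonneg fun x => abs_nonneg _
  have hA0 : 0 < A := by positivity
  have hε : 0 < e / (2 * (A + B)) := by positivity
  obtain ⟨Q, hQ⟩ := exists_polynomial_near_of_continuousOn 0 1 G hG.continuousOn _ hε
  have hQ' : ∀ u ∈ Icc (0:ℝ) 1, |Q.eval u - G u| ≤ e / (2 * (A + B)) := fun u hu => (hQ u hu).le
  have h1 := (Metric.tendsto_nhds.1 (poly_lim h0 hi hm hL Q)) (e/2) (by positivity)
  have h2 := (Metric.tendsto_nhds.1 (hL 0)) 1 one_pos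
  filter_upwards [h0, hi, h1, h2] with t h0 hi h1 h2
  have e1 := int_err h0 hi hG Q.continuous hQ'
  have e2 := int_err vol0 hm hG Q.continuous hQ'
  rw [← hB] at e2
  have e3 : ∫ x, |Real.exp (-(p₀ * x))| ∂(μ t) < A := by
    rw [Real.dist_eq] at h2
    have : ∫ x, |Real.exp (-(p₀ * x))| ∂(μ t) = ∫ x, Real.exp (-((p₀ + (0:ℕ)) * x)) ∂(μ t) := by
      simp
    rw [this]
    have := (abs_lt.1 h2).2
    have := le_abs_self (∫ x in Ioi 0, Real.exp (-((p₀ + (0:ℕ)) * x)) * m x)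
    linarith
  have e4 : e / (2 * (A + B)) * (∫ x, |Real.exp (-(p₀ * x))| ∂(μ t)) ≤ e / (2 * (A + B)) * A :=
    mul_le_mul_of_nonneg_left e3.le hε.le
  have e5 : e / (2 * (A + B)) * A + e / (2 * (A + B)) * B = e / 2 := by field_simp
  rw [Real.dist_eq] at h1 ⊢
  rw [abs_lt] at h1 ⊢
  rw [abs_le] at e1 e2
  constructor <;> linarith [e1.1, e1.2, e2.1, e2.2, h1.1, h1.2]

lemma compact_id (p₀ R y : ℝ) {h : ℝ → ℝ} (hR : ∀ y, R ≤ y → h y = 0) :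
    Real.exp (-(p₀ * y)) * (Real.exp (p₀ * -Real.log (max (Real.exp (-y)) (Real.exp (-R)))) *
      h (-Real.log (max (Real.exp (-y)) (Real.exp (-R))))) = h y := by
  rcases le_total y R with hy | hy
  · rw [max_eq_left (Real.exp_le_exp.2 (by linarith)), Real.log_exp, neg_neg, ← mul_assoc, ← Real.exp_add]
    simp
  · rw [max_eq_right (Real.exp_le_exp.2 (by linarith)), Real.log_exp, neg_neg, hR R le_rfl, hR y hy]
    simp

lemma compact_cont (p₀ R : ℝ) {h : ℝ → ℝ} (hc : Continuous h) :
    Continuous fun u => (Real.exp (p₀ * -Real.log (max u (Real.exp (-R)))) *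
      h (-Real.log (max u (Real.exp (-R))))) := by
  have : Continuous fun u : ℝ => Real.log (max u (Real.exp (-R))) :=
    Continuous.log (by fun_prop) fun u => (lt_of_lt_of_le (Real.exp_pos _) (le_max_right _ _)).ne'
  fun_prop

lemma compact_int {μ : Measure ℝ} (h0 : μ (Iic 0) = 0)
    (hi : Integrable (fun x => Real.exp (-(p₀ * x))) μ) {h : ℝ → ℝ} (hc : Continuous h) (R : ℝ)
    (hR : ∀ y, R ≤ y → h y = 0) : Integrable h μ := by
  have := int_bdd h0 hi (compact_cont p₀ R hc)
  simpa only [compact_id p₀ R _ hR] using this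

lemma compact_lim (h0 : ∀ᶠ t in l, μ t (Iic 0) = 0)
    (hi : ∀ᶠ t in l, Integrable (fun x => Real.exp (-(p₀ * x))) (μ t))
    (hm : IntegrableOn (fun x => Real.exp (-(p₀ * x)) * m x) (Ioi 0))
    (hL : ∀ n : ℕ, Tendsto (fun t => ∫ x, Real.exp (-((p₀ + n) * x)) ∂(μ t)) l
      (𝓝 (∫ x in Ioi 0, Real.exp (-((p₀ + n) * x)) * m x))) {h : ℝ → ℝ} (hc : Continuous h) (R : ℝ)
    (hR : ∀ y, R ≤ y → h y = 0) :
    Tendsto (fun t => ∫ x, h x ∂(μ t)) l (𝓝 (∫ x in Ioi 0, h x * m x)) := by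
  have := cont_lim h0 hi hm hL (compact_cont p₀ R hc)
  simp only [mul_right_comm _ (m _)] at this
  simpa only [compact_id p₀ R _ hR] using this

/-- ramp -/
def rampA (c : ℝ) (n : ℕ) (x y : ℝ) : ℝ := max 0 (min 1 ((n+1 : ℝ) * (x - y) + c))

lemma ramp_lim (hm : IntegrableOn (fun x => Real.exp (-(p₀ * x)) * m x) (Ioi 0)) (c : ℝ)
    (hc0 : 0 ≤ c) (hc1 : c ≤ 1) (x : ℝ) :
    Tendsto (fun n => ∫ y in Ioi 0, rampA c n x y * m y) atTop (𝓝 (∫ y in Ioc 0 x, m y)) := by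
  have hms : AEStronglyMeasurable m (volume.restrict (Ioi 0)) := by
    have := hm.aestronglyMeasurable.mul (f := fun x => Real.exp (-(p₀ * x)) * m x) (g := fun x => Real.exp (p₀ * x)) (Continuous.aestronglyMeasurable (by fun_prop))
    refine this.congr (Eventually.of_forall fun x => ?_)
    simp only [Pi.mul_apply]
    rw [mul_right_comm, ← Real.exp_add]; simp
  have hind : ∫ y in Ioc 0 x, m y = ∫ y in Ioi 0, (Ioc 0 x).indicator m y := by
    rw [setIntegral_indicator measurableSet_Ioc]
    congr 2
    ext y; simp
  rw [hind]
  refine tendsto_integral_of_dominated_convergence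
    (fun y => Real.exp (|p₀| * (|x|+1)) * ‖Real.exp (-(p₀ * y)) * m y‖) ?_ ?_ ?_ ?_
  · intro n
    exact (Continuous.aestronglyMeasurable (by unfold rampA; fun_prop)).mul hms
  · exact hm.norm.const_mul _
  · intro n
    refine (ae_restrict_iff' measurableSet_Ioi).2 (Eventually.of_forall fun y hy => ?_)
    have hy : 0 < y := hy
    rw [norm_mul, norm_mul, ← mul_assoc]
    refine mul_le_mul_of_nonneg_right ?_ (norm_nonneg _)
    have h1 : ‖rampA c n x y‖ ≤ 1 := by
      unfold rampA
      rw [Real.norm_of_nonneg (le_max_left _ _)]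
      exact max_le zero_le_one (min_le_left _ _)
    rcases le_total y (|x|+1) with hyx | hyx
    · refine h1.trans ?_
      rw [Real.norm_of_nonneg (Real.exp_pos _).le, ← Real.exp_add]
      refine Real.one_le_exp ?_
      have := le_abs_self p₀
      have h3 : p₀ * y ≤ |p₀| * y := mul_le_mul_of_nonneg_right this hy.le
      have h4 : |p₀| * y ≤ |p₀| * (|x|+1) := mul_le_mul_of_nonneg_left hyx (abs_nonneg _)
      linarith
    · have : rampA c n x y = 0 := by
        unfold rampA
        refine max_eq_left ((min_le_right _ _).trans ?_)
        have := le_abs_self x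
        have hn : (0:ℝ) ≤ n := Nat.cast_nonneg n
        nlinarith
      rw [this]; simp; positivity
  · have hne : ∀ᵐ y ∂(volume : Measure ℝ), y ≠ x := by
      simp [ae_iff]
    refine (ae_restrict_iff' measurableSet_Ioi).2 (hne.mono fun y hyx hy => ?_)
    have hy : 0 < y := hy
    rcases lt_or_gt_of_ne hyx with h | h
    · rw [indicator_of_mem (show y ∈ Ioc 0 x from ⟨hy, h.le⟩)]
      have : Tendsto (fun n : ℕ => (n+1:ℝ) * (x - y) + c) atTop atTop := by
        refine tendsto_atTop_add_const_right _ _ (Tendsto.atTop_mul_const (by linarith) ?_)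
        exact tendsto_atTop_add_const_right _ _ tendsto_natCast_atTop_atTop
      refine tendsto_const_nhds.congr' ?_
      filter_upwards [this.eventually_ge_atTop 1] with n hn
      rw [rampA, min_eq_left hn]; simp
    · rw [indicator_of_notMem (fun hh => absurd hh.2 (not_le.2 h))]
      have : Tendsto (fun n : ℕ => (n+1:ℝ) * (x - y) + c) atTop atBot := by
        refine tendsto_atBot_add_const_right _ _ (Tendsto.atTop_mul_const_of_neg (by linarith) ?_)
        exact tendsto_atTop_add_const_right _ _ tendsto_natCast_atTop_atTop
      refine tendsto_const_nhds.congr' ?_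
      filter_upwards [this.eventually_le_atBot 0] with n hn
      rw [rampA, max_eq_left ((min_le_right _ _).trans hn)]; simp

lemma karamata_lim (h0 : ∀ᶠ t in l, μ t (Iic 0) = 0)
    (hi : ∀ᶠ t in l, Integrable (fun x => Real.exp (-(p₀ * x))) (μ t))
    (hm : IntegrableOn (fun x => Real.exp (-(p₀ * x)) * m x) (Ioi 0))
    (hL : ∀ n : ℕ, Tendsto (fun t => ∫ x, Real.exp (-((p₀ + n) * x)) ∂(μ t)) l
      (𝓝 (∫ x in Ioi 0, Real.exp (-((p₀ + n) * x)) * m x))) (x : ℝ) :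
    Tendsto (fun t => (μ t).real (Ioc 0 x)) l (𝓝 (∫ y in Ioc 0 x, m y)) := by
  have hcont : ∀ c n, Continuous (rampA c n x) := by intro c n; unfold rampA; fun_prop
  have hz : ∀ c ≤ (1:ℝ), ∀ n y, x + 1 ≤ y → rampA c n x y = 0 := by
    intro c hc n y hy
    unfold rampA
    refine max_eq_left ((min_le_right _ _).trans ?_)
    have hn : (0:ℝ) ≤ n := Nat.cast_nonneg n
    nlinarith
  have hreal : ∀ᶠ t in l, IntegrableOn (fun _ => (1:ℝ)) (Ioc 0 x) (μ t) ∧ (μ t).real (Ioc 0 x) = ∫ y, (Ioc 0 x).indicator (fun _ => (1:ℝ)) y ∂(μ t) := by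
    filter_upwards [h0, hi] with t h0 hi
    refine ⟨?_, ?_⟩
    · have h2 : IntegrableOn (rampA 1 0 x) (Ioc 0 x) (μ t) :=
        (compact_int h0 hi (hcont 1 0) (x+1) (hz 1 le_rfl 0)).integrableOn
      refine h2.congr_fun (fun y hy => ?_) measurableSet_Ioc
      unfold rampA
      rw [min_eq_left]
      · simp
      · have := hy.2
        simp; linarith
    · rw [integral_indicator measurableSet_Ioc]; simp [Measure.real]
  rw [tendsto_order]
  constructor
  · intro a ha
    obtain ⟨n, hn⟩ := (((ramp_lim hm 0 le_rfl zero_le_one x)).eventually_const_lt ha).exists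
    filter_upwards [h0, hi, hreal, (compact_lim h0 hi hm hL (hcont 0 n) (x+1) (hz 0 zero_le_one n)).eventually_const_lt hn] with t h0 hi hr ht
    refine ht.trans_le ?_
    rw [hr.2]
    refine integral_mono_ae (compact_int h0 hi (hcont 0 n) (x+1) (hz 0 zero_le_one n)) (hr.1.integrable_indicator measurableSet_Ioc) ?_
    have : ∀ᵐ x ∂(μ t), x ∉ Iic 0 := measure_eq_zero_iff_ae_notMem.1 h0
    filter_upwards [this] with y hy
    have hy : 0 < y := not_le.1 hy
    by_cases hyx : y ≤ x
    · rw [indicator_of_mem (show y ∈ Ioc 0 x from ⟨hy, hyx⟩)]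
      exact max_le zero_le_one (min_le_left _ _)
    · rw [indicator_of_notMem (fun hh => hyx hh.2)]
      refine max_le le_rfl ((min_le_right _ _).trans ?_)
      have hn : (0:ℝ) ≤ n := Nat.cast_nonneg n
      nlinarith
  · intro a ha
    obtain ⟨n, hn⟩ := (((ramp_lim hm 1 zero_le_one le_rfl x)).eventually_lt_const ha).exists
    filter_upwards [h0, hi, hreal, (compact_lim h0 hi hm hL (hcont 1 n) (x+1) (hz 1 le_rfl n)).eventually_lt_const hn] with t h0 hi hr ht
    refine lt_of_le_of_lt ?_ ht
    rw [hr.2]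
    refine integral_mono_ae (hr.1.integrable_indicator measurableSet_Ioc) (compact_int h0 hi (hcont 1 n) (x+1) (hz 1 le_rfl n)) ?_
    refine Eventually.of_forall fun y => ?_
    by_cases hyx : y ∈ Ioc 0 x
    · rw [indicator_of_mem hyx]
      refine (le_min le_rfl ?_).trans (le_max_right _ _)
      have hn : (0:ℝ) ≤ n := Nat.cast_nonneg n
      nlinarith [hyx.2]
    · rw [indicator_of_notMem hyx]
      exact le_max_left _ _
end cont

/-- numerator of kernel -/
def hN (z : ℝ) : ℝ := z * (1 + Real.exp (-z)) - 2 * (1 - Real.exp (-z))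
/-- kernel -/
def kK (z : ℝ) : ℝ := hN z / z ^ 3
/-- w -/
def wF (z : ℝ) : ℝ := 1 - (1 - Real.exp (-z)) / z

lemma hN_deriv (z : ℝ) : HasDerivAt hN (1 - Real.exp (-z) * (1 + z)) z := by
  have he : HasDerivAt (fun z : ℝ => Real.exp (-z)) (-Real.exp (-z)) z := by
    simpa using (hasDerivAt_neg z).exp
  have := ((hasDerivAt_id z).mul (he.const_add 1)).sub ((he.const_sub 1).const_mul 2)
  refine this.congr_deriv ?_
  simp; ring

lemma hN_pos {z : ℝ} (hz : 0 < z) : 0 < hN z := by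
  have hm : StrictMonoOn hN (Ici 0) := by
    refine strictMonoOn_of_deriv_pos (convex_Ici 0) (fun x _ => (hN_deriv x).continuousAt.continuousWithinAt) ?_
    intro x hx
    rw [interior_Ici] at hx
    have hx : 0 < x := hx
    rw [(hN_deriv x).deriv, Real.exp_neg]
    have := Real.add_one_lt_exp hx.ne'
    have h2 := Real.exp_pos x
    rw [sub_pos, inv_mul_lt_iff₀ h2]; linarith
  have := hm (mem_Ici.2 le_rfl) (mem_Ici.2 hz.le) hz
  simpa [hN] using this

lemma hN_le {z : ℝ} (hz : 0 ≤ z) : hN z ≤ z ^ 3 := by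
  have hd : ∀ x, HasDerivAt (fun z => z^3 - hN z) (3 * x^2 - (1 - Real.exp (-x) * (1 + x))) x := by
    intro x
    exact ((hasDerivAt_pow 3 x).sub (hN_deriv x)).congr_deriv (by norm_num)
  have hm : MonotoneOn (fun z => z^3 - hN z) (Ici 0) := by
    refine monotoneOn_of_deriv_nonneg (convex_Ici 0) (fun x _ => (hd x).continuousAt.continuousWithinAt) (fun x _ => (hd x).differentiableAt.differentiableWithinAt) ?_
    intro x hx
    rw [interior_Ici] at hx
    have hx : 0 < x := hx
    rw [(hd x).deriv]
    have := Real.add_one_le_exp (-x)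
    nlinarith
  have := hm (mem_Ici.2 le_rfl) (mem_Ici.2 hz) hz
  have h0 : hN 0 = 0 := by simp [hN]
  simp only [h0] at this
  linarith

lemma kK_pos {z : ℝ} (hz : 0 < z) : 0 < kK z := div_pos (hN_pos hz) (by positivity)
lemma kK_le_one {z : ℝ} (hz : 0 < z) : kK z ≤ 1 := by
  rw [kK, div_le_one (by positivity)]; exact hN_le hz.le
lemma kK_le {z : ℝ} (hz : 0 < z) : kK z ≤ 2 / z ^ 2 := by
  rw [kK, div_le_div_iff₀ (by positivity) (by positivity), hN]
  have h1 : Real.exp (-z) ≤ 1 := by simpa using hz.le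
  have : z * (1 + Real.exp (-z)) - 2 * (1 - Real.exp (-z)) ≤ 2 * z := by nlinarith
  calc _ ≤ 2 * z * z^2 := by gcongr
    _ = _ := by ring
lemma kK_meas : Measurable kK := by unfold kK hN; fun_prop

lemma wF_nonneg {z : ℝ} (hz : 0 < z) : 0 ≤ wF z := by
  rw [wF, sub_nonneg, div_le_one hz]
  linarith [Real.add_one_le_exp (-z)]
lemma wF_pos {z : ℝ} (hz : 0 < z) : 0 < wF z := by
  rw [wF, sub_pos, div_lt_one hz]
  linarith [Real.add_one_lt_exp (show -z ≠ 0 by linarith)]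
lemma wF_lt_one {z : ℝ} (hz : 0 < z) : wF z < 1 := by
  have : 0 < (1 - Real.exp (-z)) / z := div_pos (by simpa using hz) hz
  rw [wF]; linarith
lemma wF_meas : Measurable wF := by unfold wF; fun_prop
lemma wF_mono : MonotoneOn wF (Ioi 0) := by
  intro x hx y hy hxy
  have hx : 0 < x := hx
  have hy : 0 < y := hy
  rcases hxy.eq_or_lt with rfl | hlt
  · exact le_rfl
  have hc : ConvexOn ℝ univ (fun x : ℝ => Real.exp (-x)) := by
    exact convexOn_exp.comp_linearMap (-LinearMap.id : ℝ →ₗ[ℝ] ℝ)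
  have := hc.secant_mono (a := 0) (x := x) (y := y) trivial trivial trivial hx.ne' hy.ne' hlt.le
  simp only [neg_zero, Real.exp_zero, sub_zero] at this
  rw [wF, wF]
  have e : ∀ z : ℝ, (1 - Real.exp (-z)) / z = - ((Real.exp (-z) - 1) / z) := by intro z; ring
  rw [e, e]; linarith
lemma wF_le {z : ℝ} (hz : 0 < z) : wF z ≤ z := by
  rcases le_total z 1 with h | h
  · have := Real.abs_exp_sub_one_sub_id_le (x := -z) (by rw [abs_neg, abs_of_pos hz]; exact h)
    have h2 := (abs_le.1 this).2
    rw [wF, sub_le_iff_le_add, ← sub_le_iff_le_add', le_div_iff₀ hz]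
    nlinarith
  · exact (wF_lt_one hz).le.trans h
lemma wF_cont {z : ℝ} (hz : 0 < z) : ContinuousAt wF z := by
  unfold wF
  have : z ≠ 0 := hz.ne'
  fun_prop (disch := assumption)
lemma wF_tendsto : Tendsto wF atTop (𝓝 1) := by
  have h1 : Tendsto (fun z : ℝ => 1 - 1/z) atTop (𝓝 1) := by
    have : Tendsto (fun z : ℝ => 1 / z) atTop (𝓝 0) := by simpa using tendsto_inv_atTop_zero (𝕜 := ℝ)
    simpa using this.const_sub (1:ℝ)
  refine tendsto_of_tendsto_of_tendsto_of_le_of_le' h1 tendsto_const_nhds ?_ ?_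
  · filter_upwards [eventually_gt_atTop 0] with z hz
    rw [wF]
    have := Real.exp_pos (-z)
    gcongr; linarith
  · filter_upwards [eventually_gt_atTop 0] with z hz
    exact (wF_lt_one hz).le

lemma kK_lint {a : ℝ} (ha : 0 < a) : ∫⁻ v in Ioi a, ENNReal.ofReal (kK v) = ENNReal.ofReal (wF a / a) := by
  have hd : ∀ x ∈ Ici a, HasDerivAt (fun u => -(wF u / u)) (kK x) x := by
    intro x hx
    have hx : 0 < x := ha.trans_le hx
    have he : HasDerivAt (fun z : ℝ => Real.exp (-z)) (-Real.exp (-x)) x := by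
      simpa using (hasDerivAt_neg x).exp
    have hw : HasDerivAt wF (-((Real.exp (-x) * x - (1 - Real.exp (-x)) * 1) / x^2)) x := by
      have := (((he.const_sub 1).div (hasDerivAt_id x) hx.ne').const_sub 1)
      exact this.congr_deriv (by simp)
    have := (hw.div (hasDerivAt_id x) hx.ne').neg
    refine this.congr_deriv ?_
    simp only [kK, hN, wF, id]
    field_simp
    ring
  have ht : Tendsto (fun u => -(wF u / u)) atTop (𝓝 0) := by
    have := (wF_tendsto.mul (tendsto_inv_atTop_zero (𝕜 := ℝ))).neg
    simpa [div_eq_mul_inv] using this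
  have hpos : ∀ x ∈ Ioi a, 0 ≤ kK x := fun x hx => (kK_pos (ha.trans hx)).le
  have h1 := integral_Ioi_of_hasDerivAt_of_nonneg' hd hpos ht
  have h2 := integrableOn_Ioi_deriv_of_nonneg' hd hpos ht
  rw [← ofReal_integral_eq_lintegral_ofReal h2 ((ae_restrict_iff' measurableSet_Ioi).2 (Eventually.of_forall hpos)), h1]
  simp

/-- W -/
def WW (P : Measure ℝ) (s : ℝ) : ℝ := ∫ x, wF (s * x) ∂P
/-- U -/
def UU (P : Measure ℝ) (x : ℝ) : ℝ := ∫ y in Ioc 0 x, y ∂P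

section WU
variable {P : Measure ℝ} [IsProbabilityMeasure P]

lemma ae_pos (hP : P (Iic 0) = 0) : ∀ᵐ x ∂P, 0 < x := by
  have : ∀ᵐ x ∂P, x ∉ Iic 0 := measure_eq_zero_iff_ae_notMem.1 hP
  filter_upwards [this] with x hx using not_le.1 hx

lemma wF_int (hP : P (Iic 0) = 0) {s : ℝ} (hs : 0 < s) : Integrable (fun x => wF (s * x)) P := by
  refine (integrable_const (1:ℝ)).mono' (wF_meas.comp (measurable_const_mul s)).aestronglyMeasurable ?_
  filter_upwards [ae_pos hP] with x hx
  rw [Real.norm_of_nonneg (wF_nonneg (by positivity))]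
  exact (wF_lt_one (by positivity)).le

lemma WW_mono (hP : P (Iic 0) = 0) : MonotoneOn (WW P) (Ioi 0) := by
  intro a ha b hb hab
  have ha : 0 < a := ha
  have hb : 0 < b := hb
  refine integral_mono_ae (wF_int hP ha) (wF_int hP hb) ?_
  filter_upwards [ae_pos hP] with x hx
  exact wF_mono (mem_Ioi.2 (by positivity)) (mem_Ioi.2 (by positivity)) (by gcongr)

lemma WW_pos (hP : P (Iic 0) = 0) {s : ℝ} (hs : 0 < s) : 0 < WW P s := by
  have h0 : 0 ≤ᵐ[P] fun x => wF (s * x) := by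
    filter_upwards [ae_pos hP] with x hx using wF_nonneg (by positivity)
  refine lt_of_le_of_ne (integral_nonneg_of_ae h0) fun h => ?_
  have := (integral_eq_zero_iff_of_nonneg_ae h0 (wF_int hP hs)).1 h.symm
  have hF : ∀ᵐ x ∂P, False := by
    filter_upwards [this, ae_pos hP] with x h1 h2
    exact (wF_pos (show 0 < s * x by positivity)).ne' h1
  simp at hF
  exact (IsProbabilityMeasure.ne_zero P) hF

lemma WW_lim (hP : P (Iic 0) = 0) {l : Filter ℝ} [l.IsCountablyGenerated] {g : ℝ → ℝ} (hl : ∀ᶠ s in l, 0 < s)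
    (hg : ∀ x, 0 < x → Tendsto (fun s => wF (s * x)) l (𝓝 (g x))) :
    Tendsto (WW P) l (𝓝 (∫ x, g x ∂P)) := by
  refine tendsto_integral_filter_of_dominated_convergence (fun _ => (1:ℝ)) ?_ ?_ (integrable_const _) ?_
  · exact Eventually.of_forall fun s => (wF_meas.comp (measurable_const_mul s)).aestronglyMeasurable
  · filter_upwards [hl] with s hs
    filter_upwards [ae_pos hP] with x hx
    rw [Real.norm_of_nonneg (wF_nonneg (by positivity))]
    exact (wF_lt_one (by positivity)).le
  · filter_upwards [ae_pos hP] with x hx using hg x hx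

lemma WW_cont (hP : P (Iic 0) = 0) : ContinuousOn (WW P) (Ioi 0) := by
  intro s hs
  have hs : 0 < s := hs
  refine ContinuousAt.continuousWithinAt ?_
  refine WW_lim hP (lt_mem_nhds hs) fun x hx => ?_
  exact (wF_cont (show 0 < s * x by positivity)).tendsto.comp ((continuous_mul_const x).tendsto s)

lemma WW_zero (hP : P (Iic 0) = 0) : Tendsto (WW P) (𝓝[>] 0) (𝓝 0) := by
  have := WW_lim hP (l := 𝓝[>] 0) (g := fun _ => 0) self_mem_nhdsWithin fun x hx => ?_
  · simpa using this
  · have h1 : Tendsto (fun s : ℝ => s * x) (𝓝[>] 0) (𝓝 0) := by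
      have := ((continuous_mul_const x).tendsto (0:ℝ)).mono_left (nhdsWithin_le_nhds (s := Ioi 0))
      simpa using this
    refine tendsto_of_tendsto_of_tendsto_of_le_of_le' tendsto_const_nhds h1 ?_ ?_
    · filter_upwards [self_mem_nhdsWithin] with s hs
      have hs : 0 < s := hs
      exact wF_nonneg (by positivity)
    · filter_upwards [self_mem_nhdsWithin] with s hs
      have hs : 0 < s := hs
      exact wF_le (by positivity)

lemma WW_top (hP : P (Iic 0) = 0) : Tendsto (WW P) atTop (𝓝 1) := by
  have := WW_lim hP (l := atTop) (g := fun _ => 1) (eventually_gt_atTop 0) fun x hx => ?_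
  · simpa using this
  · exact wF_tendsto.comp (tendsto_id.atTop_mul_const hx)

lemma UU_int (x : ℝ) : IntegrableOn (fun y => y) (Ioc 0 x) P := by
  refine Measure.integrableOn_of_bounded (M := x) (measure_ne_top _ _) measurable_id.aestronglyMeasurable ?_
  refine (ae_restrict_iff' measurableSet_Ioc).2 (Eventually.of_forall fun y hy => ?_)
  rw [Real.norm_of_nonneg hy.1.le]; exact hy.2

lemma UU_nonneg (x : ℝ) : 0 ≤ UU P x := setIntegral_nonneg measurableSet_Ioc fun y hy => hy.1.le

lemma UU_mono : Monotone (UU P) := by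
  intro a b hab
  refine setIntegral_mono_set (UU_int b) ?_ (Ioc_subset_Ioc_right hab).eventuallyLE
  exact (ae_restrict_iff' measurableSet_Ioc).2 (Eventually.of_forall fun y hy => hy.1.le)

lemma WW_eq (hP : P (Iic 0) = 0) {s : ℝ} (hs : 0 < s) :
    WW P s = ∫ v in Ioi 0, s * (kK v * UU P (v / s)) := by
  have h0 : 0 ≤ᵐ[P] fun x => wF (s * x) := by
    filter_upwards [ae_pos hP] with x hx using wF_nonneg (by positivity)
  rw [WW, integral_eq_lintegral_of_nonneg_ae h0 (wF_int hP hs).aestronglyMeasurable]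
  rw [integral_eq_lintegral_of_nonneg_ae]
  rotate_left
  · refine (ae_restrict_iff' measurableSet_Ioi).2 (Eventually.of_forall fun v hv => ?_)
    exact mul_nonneg hs.le (mul_nonneg (kK_pos hv).le (UU_nonneg _))
  · exact (measurable_const.mul (kK_meas.mul (UU_mono.measurable.comp (measurable_id.div_const s)))).aestronglyMeasurable
  congr 1
  have hmeas : Measurable fun q : ℝ × ℝ => (if 0 < q.1 ∧ q.1 ≤ q.2 / s then ENNReal.ofReal (s * q.1) * ENNReal.ofReal (kK q.2) else 0) := by
    refine Measurable.ite ?_ ?_ measurable_const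
    · exact (measurableSet_lt measurable_const measurable_fst).inter
        (measurableSet_le measurable_fst (measurable_snd.div_const s))
    · exact (ENNReal.measurable_ofReal.comp (measurable_fst.const_mul s)).mul (ENNReal.measurable_ofReal.comp (kK_meas.comp measurable_snd))
  calc ∫⁻ x, ENNReal.ofReal (wF (s * x)) ∂P
      = ∫⁻ x, (∫⁻ v in Ioi 0, (if 0 < x ∧ x ≤ v / s then ENNReal.ofReal (s * x) * ENNReal.ofReal (kK v) else 0)) ∂P := by
        refine lintegral_congr_ae ?_
        filter_upwards [ae_pos hP] with x hx
        have hsx : 0 < s * x := by positivity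
        have e1 : ∀ v, (if 0 < x ∧ x ≤ v / s then ENNReal.ofReal (s * x) * ENNReal.ofReal (kK v) else 0)
          = (Ici (s*x)).indicator (fun v => ENNReal.ofReal (s * x) * ENNReal.ofReal (kK v)) v := by
          intro v
          simp only [indicator, mem_Ici, hx, true_and, le_div_iff₀ hs, mul_comm x s]
        simp only [e1]
        rw [lintegral_indicator measurableSet_Ici, Measure.restrict_restrict measurableSet_Ici,
          inter_eq_left.2 (show Ici (s*x) ⊆ Ioi 0 from fun v hv => hsx.trans_le hv), setLIntegral_congr Ioi_ae_eq_Ici.symm,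
          lintegral_const_mul _ kK_meas.ennreal_ofReal, kK_lint hsx, ← ENNReal.ofReal_mul hsx.le]
        congr 1; field_simp
    _ = ∫⁻ v in Ioi 0, ∫⁻ x, (if 0 < x ∧ x ≤ v / s then ENNReal.ofReal (s * x) * ENNReal.ofReal (kK v) else 0) ∂P :=
        lintegral_lintegral_swap hmeas.aemeasurable
    _ = _ := by
        refine setLIntegral_congr_fun measurableSet_Ioi fun v hv => ?_
        have e1 : ∀ x, (if 0 < x ∧ x ≤ v / s then ENNReal.ofReal (s * x) * ENNReal.ofReal (kK v) else 0)
          = (Ioc 0 (v/s)).indicator (fun x => ENNReal.ofReal (s * kK v) * ENNReal.ofReal x) x := by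
          intro x
          simp only [indicator, mem_Ioc]
          split_ifs with h
          · rw [← ENNReal.ofReal_mul (by have := h.1; positivity), ← ENNReal.ofReal_mul (mul_nonneg hs.le (kK_pos hv).le)]
            congr 1; ring
          · rfl
        simp only [e1]
        rw [lintegral_indicator measurableSet_Ioc, lintegral_const_mul _ ENNReal.measurable_ofReal,
          ← ofReal_integral_eq_lintegral_ofReal (UU_int _)
            ((ae_restrict_iff' measurableSet_Ioc).2 (Eventually.of_forall fun y hy => hy.1.le)),
          ← ENNReal.ofReal_mul (mul_nonneg hs.le (kK_pos hv).le), UU, mul_assoc]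

lemma potter {U : ℝ → ℝ} (hU : Monotone U) {ρ : ℝ} (hρ : 0 < ρ) (hρ1 : ρ ≤ 1)
    (hr : ∀ c : ℝ, 0 < c → Tendsto (fun x => U (c * x) / U x) atTop (𝓝 (c ^ (1-ρ))))
    (hp : ∀ᶠ x in atTop, 0 < U x) :
    ∀ᶠ x in atTop, 0 < x ∧ 0 < U x ∧ ∀ y, 1 ≤ y → U (y * x) / U x ≤ (2*y) ^ (1-ρ/2) := by
  have h2 : (2:ℝ) ^ (1-ρ) < 2 ^ (1-ρ/2) := Real.rpow_lt_rpow_of_exponent_lt (by norm_num) (by linarith)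
  obtain ⟨X, hX⟩ := eventually_atTop.1 (((hr 2 two_pos).eventually_lt_const h2).and (hp.and (eventually_gt_atTop 0)))
  filter_upwards [eventually_ge_atTop X] with x hx
  obtain ⟨-, hUx, hx0⟩ := hX x hx
  refine ⟨hx0, hUx, fun y hy => ?_⟩
  have hind : ∀ n : ℕ, U (2^n * x) ≤ ((2:ℝ)^n) ^ (1-ρ/2) * U x := by
    intro n
    induction n with
    | zero => simp
    | succ n ih =>
      have hge : X ≤ 2^n * x := hx.trans (le_mul_of_one_le_left hx0.le (one_le_pow₀ (by norm_num)))
      obtain ⟨h3, h4, -⟩ := hX _ hge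
      rw [div_lt_iff₀ h4] at h3
      rw [pow_succ', mul_assoc, Real.mul_rpow (by norm_num) (by positivity), mul_assoc]
      exact h3.le.trans (by gcongr)
  obtain ⟨n, hn1, hn2⟩ := exists_nat_pow_near hy (one_lt_two)
  rw [div_le_iff₀ hUx]
  calc U (y * x) ≤ U (2^(n+1) * x) := hU (by gcongr)
    _ ≤ _ := hind _
    _ ≤ _ := by
      gcongr
      · linarith
      · rw [pow_succ']; gcongr

/-- dominating function -/
def domK (ρ v : ℝ) : ℝ := if v ≤ 1 then 1 else 8 * v ^ (-1 - ρ/2)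

lemma domK_int {ρ : ℝ} (hρ : 0 < ρ) : IntegrableOn (domK ρ) (Ioi 0) := by
  rw [← Ioc_union_Ioi_eq_Ioi (zero_le_one (α := ℝ))]
  refine IntegrableOn.union ?_ ?_
  · refine IntegrableOn.congr_fun (f := fun _ => (1:ℝ)) (by simp) (fun v hv => ?_) measurableSet_Ioc
    simp [domK, hv.2]
  · refine IntegrableOn.congr_fun (f := fun v => 8 * v ^ (-1 - ρ/2)) ?_ (fun v hv => ?_) measurableSet_Ioi
    · exact (integrableOn_Ioi_rpow_of_lt (by linarith) one_pos).const_mul 8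
    · have hv : 1 < v := hv
      simp [domK, not_le.2 hv]

lemma WW_asym (hP : P (Iic 0) = 0) {ρ : ℝ} (hρ : 0 < ρ) (hρ1 : ρ ≤ 1)
    (hr : ∀ c : ℝ, 0 < c → Tendsto (fun x => UU P (c * x) / UU P x) atTop (𝓝 (c ^ (1-ρ))))
    (hp : ∀ᶠ x in atTop, 0 < UU P x) :
    ∃ C, 0 < C ∧ Tendsto (fun x => WW P (1/x) * x / UU P x) atTop (𝓝 C) := by
  have hpot := potter UU_mono hρ hρ1 hr hp
  have hdom : ∀ᶠ x in atTop, ∀ v, 0 < v → ‖kK v * (UU P (v * x) / UU P x)‖ ≤ domK ρ v := by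
    filter_upwards [hpot] with x hx v hv
    obtain ⟨hx0, hUx, hx2⟩ := hx
    have hq : 0 ≤ UU P (v * x) / UU P x := div_nonneg (UU_nonneg _) hUx.le
    rw [Real.norm_of_nonneg (mul_nonneg (kK_pos hv).le hq), domK]
    split_ifs with h1
    · refine mul_le_one₀ (kK_le_one hv) hq ?_
      rw [div_le_one hUx]
      exact UU_mono (by nlinarith)
    · have h1 : 1 < v := not_le.1 h1
      calc _ ≤ (2 / v^2) * (2*v)^(1-ρ/2) := mul_le_mul (kK_le hv) (hx2 v h1.le) hq (by positivity)
        _ ≤ (2 / v^2) * (2 * v^(1-ρ/2)) := by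
          rw [Real.mul_rpow (by norm_num) hv.le]
          gcongr
          calc (2:ℝ)^(1-ρ/2) ≤ 2^(1:ℝ) := Real.rpow_le_rpow_of_exponent_le (by norm_num) (by linarith)
            _ = 2 := by simp
        _ ≤ 8 * v^(-1-ρ/2) := by
          have e : v^(1-ρ/2) = v^2 * v^(-1-ρ/2) := by
            rw [← Real.rpow_natCast, ← Real.rpow_add hv]; congr 1; push_cast; ring
          rw [e]
          have : 0 < v^(-1-ρ/2) := by positivity
          have e2 : 2 / v^2 * (2 * (v^2 * v^(-1-ρ/2))) = 4 * v^(-1-ρ/2) := by field_simp; ring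
          rw [e2]; linarith
  have hlim : ∀ v, 0 < v → Tendsto (fun x => kK v * (UU P (v * x) / UU P x)) atTop (𝓝 (kK v * v^(1-ρ))) :=
    fun v hv => (hr v hv).const_mul _
  refine ⟨∫ v in Ioi 0, kK v * v^(1-ρ), ?_, ?_⟩
  · have hIntg : IntegrableOn (fun v => kK v * v^(1-ρ)) (Ioi 0) := by
      refine (domK_int hρ).mono' (kK_meas.mul (measurable_id.pow_const _)).aestronglyMeasurable ?_
      refine (ae_restrict_iff' measurableSet_Ioi).2 (Eventually.of_forall fun v hv => ?_)
      exact le_of_tendsto (hlim v hv).norm (hdom.mono fun x hx => hx v hv)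
    rw [setIntegral_pos_iff_support_of_nonneg_ae]
    · have : Function.support (fun v => kK v * v^(1-ρ)) ∩ Ioi 0 = Ioi 0 := by
        refine inter_eq_right.2 fun v hv => ?_
        exact (mul_pos (kK_pos hv) (Real.rpow_pos_of_pos hv _)).ne'
      rw [this]; simp
    · refine (ae_restrict_iff' measurableSet_Ioi).2 (Eventually.of_forall fun v hv => ?_)
      exact (mul_pos (kK_pos hv) (Real.rpow_pos_of_pos hv _)).le
    · exact hIntg
  · have h : Tendsto (fun x => ∫ v in Ioi 0, kK v * (UU P (v * x) / UU P x)) atTop (𝓝 (∫ v in Ioi 0, kK v * v^(1-ρ))) := by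
      refine tendsto_integral_filter_of_dominated_convergence (domK ρ) ?_ ?_ (domK_int hρ) ?_
      · refine Eventually.of_forall fun x => ?_
        exact (kK_meas.mul ((UU_mono.measurable.comp (measurable_id.mul_const x)).div_const _)).aestronglyMeasurable
      · filter_upwards [hdom] with x hx
        exact (ae_restrict_iff' measurableSet_Ioi).2 (Eventually.of_forall hx)
      · exact (ae_restrict_iff' measurableSet_Ioi).2 (Eventually.of_forall hlim)
    refine h.congr' ?_
    filter_upwards [hpot] with x hx
    rw [WW_eq hP (show 0 < 1/x by have := hx.1; positivity), integral_const_mul]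
    have hx0 := hx.1.ne'
    have e : ∀ v, v / (1/x) = v * x := by intro v; simp
    simp only [e, ← mul_div_assoc, integral_div]
    rw [one_div, inv_mul_eq_div, div_mul_cancel₀ _ hx0]

lemma WW_ratio (hP : P (Iic 0) = 0) {ρ : ℝ} (hρ : 0 < ρ) (hρ1 : ρ ≤ 1)
    (hr : ∀ c : ℝ, 0 < c → Tendsto (fun x => UU P (c * x) / UU P x) atTop (𝓝 (c ^ (1-ρ))))
    (hp : ∀ᶠ x in atTop, 0 < UU P x) {c : ℝ} (hc : 0 < c) :
    Tendsto (fun d => WW P (d * c) / WW P d) (𝓝[>] 0) (𝓝 (c ^ ρ)) := by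
  obtain ⟨C, hC, hlim⟩ := WW_asym hP hρ hρ1 hr hp
  have hc' : 0 < c⁻¹ := inv_pos.2 hc
  have h1 := hlim.comp (tendsto_id.const_mul_atTop hc')
  have h2 := ((h1.div hlim hC.ne').mul (hr _ hc')).mul_const c
  have e : C / C * c⁻¹ ^ (1-ρ) * c = c ^ ρ := by
    rw [div_self hC.ne', one_mul, Real.inv_rpow hc.le, ← Real.rpow_neg hc.le]
    nth_rewrite 2 [← Real.rpow_one c]
    rw [← Real.rpow_add hc]; congr 1; ring
  rw [e] at h2
  have h3 : Tendsto (fun x => WW P (x⁻¹ * c) / WW P x⁻¹) atTop (𝓝 (c^ρ)) := by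
    refine h2.congr' ?_
    filter_upwards [hp, eventually_gt_atTop 0, (tendsto_id.const_mul_atTop hc').eventually hp] with x h1 h2 h3
    have h3 : 0 < UU P (c⁻¹ * x) := h3
    have hw := WW_pos hP (inv_pos.2 h2)
    simp only [Function.comp, id, Pi.div_apply, one_div, mul_inv, inv_inv]
    rw [mul_comm x⁻¹ c]
    generalize UU P (c⁻¹ * x) = A at *
    generalize UU P x = B at *
    generalize WW P (c * x⁻¹) = D at *
    generalize WW P x⁻¹ = E at *
    field_simp
  have := h3.comp tendsto_inv_nhdsGT_zero
  refine this.congr fun d => ?_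
  simp
end WU

section wd
variable {ν : Measure ℝ}

/-- size-biased measure -/
def szb (ν : Measure ℝ) : Measure ℝ := ν.withDensity ENNReal.ofReal

lemma szb_zero (h : ν (Iic 0) = 0) : szb ν (Iic 0) = 0 :=
  withDensity_absolutelyContinuous _ _ h

lemma ae_pos' (h : ν (Iic 0) = 0) : ∀ᵐ x ∂ν, 0 < x := by
  have : ∀ᵐ x ∂ν, x ∉ Iic 0 := measure_eq_zero_iff_ae_notMem.1 h
  filter_upwards [this] with x hx using not_le.1 hx

lemma szb_prob (hm : ∫⁻ x, ENNReal.ofReal x ∂ν = 1) : IsProbabilityMeasure (szb ν) :=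
  ⟨by rw [szb, withDensity_apply _ MeasurableSet.univ]; simpa using hm⟩

lemma szb_integral (h : ν (Iic 0) = 0) (f : ℝ → ℝ) : ∫ x, f x ∂(szb ν) = ∫ x, x * f x ∂ν := by
  rw [szb, integral_withDensity_eq_integral_toReal_smul ENNReal.measurable_ofReal (by simp)]
  refine integral_congr_ae ?_
  filter_upwards [ae_pos' h] with x hx
  simp [ENNReal.toReal_ofReal hx.le]

lemma szb_integrable (h : ν (Iic 0) = 0) {f : ℝ → ℝ} (hf : Integrable (fun x => x * f x) ν) :
    Integrable f (szb ν) := by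
  rw [szb, integrable_withDensity_iff_integrable_smul' ENNReal.measurable_ofReal (by simp)]
  refine hf.congr ?_
  filter_upwards [ae_pos' h] with x hx
  simp [ENNReal.toReal_ofReal hx.le]

lemma szb_setIntegral (x : ℝ) (f : ℝ → ℝ) :
    ∫ y in Ioc 0 x, f y ∂(szb ν) = ∫ y in Ioc 0 x, y * f y ∂ν := by
  rw [szb, setIntegral_withDensity_eq_setIntegral_toReal_smul ENNReal.measurable_ofReal (by simp) _ measurableSet_Ioc]
  refine setIntegral_congr_fun measurableSet_Ioc fun y hy => ?_
  simp [ENNReal.toReal_ofReal hy.1.le]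

lemma id_int (h : ν (Iic 0) = 0) (hm : ∫⁻ x, ENNReal.ofReal x ∂ν = 1) :
    Integrable (fun x => x) ν ∧ ∫ x, x ∂ν = 1 := by
  have h0 : 0 ≤ᵐ[ν] fun x => x := (ae_pos' h).mono fun x hx => hx.le
  constructor
  · refine ⟨measurable_id.aestronglyMeasurable, ?_⟩
    rw [hasFiniteIntegral_iff_ofReal h0, hm]; simp
  · rw [integral_eq_lintegral_of_nonneg_ae h0 measurable_id.aestronglyMeasurable, hm]; simp

lemma phi_eq (h : ν (Iic 0) = 0) (hm : ∫⁻ x, ENNReal.ofReal x ∂ν = 1) {s : ℝ} (hs : 0 < s) :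
    ∫ x, (1 - Real.exp (-(s * x))) ∂ν = s * (1 - WW (szb ν) s) := by
  obtain ⟨hi, h1⟩ := id_int h hm
  have hj : Integrable (fun x => 1 - Real.exp (-(s*x))) ν := by
    refine (hi.const_mul s).mono' (by fun_prop) ?_
    filter_upwards [ae_pos' h] with x hx
    have h1 : Real.exp (-(s*x)) ≤ 1 := by simp; positivity
    have h2 := Real.add_one_le_exp (-(s*x))
    rw [Real.norm_of_nonneg (by linarith)]; linarith
  have e : ∫ x, x * wF (s * x) ∂ν = ∫ x, (x - (1 - Real.exp (-(s*x))) / s) ∂ν := by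
    refine integral_congr_ae ?_
    filter_upwards [ae_pos' h] with x hx
    rw [wF]; field_simp
  rw [WW, szb_integral h, e, integral_sub hi (hj.div_const s), h1, integral_div]
  field_simp; ring

lemma U_eq (x : ℝ) : ∫ y in Ioc 0 x, y ^ 2 ∂ν = UU (szb ν) x := by
  rw [UU, szb_setIntegral]; simp only [pow_two]

end wd

lemma rv_of_tail {U L : ℝ → ℝ} {ρ : ℝ} (hLpos : ∀ x : ℝ, 0 < x → 0 < L x)
    (hLslow : ∀ c : ℝ, 0 < c → Tendsto (fun x => L (c * x) / L x) atTop (𝓝 1))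
    (htail : Tendsto (fun x => U x / (x ^ (1 - ρ) * L x)) atTop (𝓝 1)) :
    (∀ᶠ x in atTop, 0 < U x) ∧
    ∀ c : ℝ, 0 < c → Tendsto (fun x => U (c * x) / U x) atTop (𝓝 (c ^ (1-ρ))) := by
  have hp : ∀ᶠ x in atTop, 0 < U x := by
    filter_upwards [htail.eventually_const_lt zero_lt_one, eventually_gt_atTop 0] with x h1 h2
    have : 0 < x^(1-ρ) * L x := mul_pos (Real.rpow_pos_of_pos h2 _) (hLpos x h2)
    exact (div_pos_iff_of_pos_right this).1 h1
  refine ⟨hp, fun c hc => ?_⟩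
  have h1 := htail.comp (tendsto_id.const_mul_atTop hc)
  have h2 := ((h1.mul (hLslow c hc)).mul_const (c^(1-ρ))).div htail one_ne_zero
  simp only [one_mul, mul_one, div_one] at h2
  refine h2.congr' ?_
  filter_upwards [hp, eventually_gt_atTop 0] with x h1 h2
  have hcx : 0 < c * x := by positivity
  have a1 := hLpos x h2
  have a2 := hLpos _ hcx
  have a3 : 0 < c^(1-ρ) := by positivity
  have a4 : 0 < x^(1-ρ) := by positivity
  simp only [Function.comp, id, Pi.div_apply]
  rw [Real.mul_rpow hc.le h2.le]
  generalize L (c*x) = A at *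
  generalize U (c*x) = B at *
  field_simp

/-- P -/
def pP (ρ a : ℝ) : ℝ := a + a ^ (1 + ρ)

lemma pP_mono {ρ a b : ℝ} (hρ : 0 < ρ) (ha : 0 ≤ a) (hab : a < b) : pP ρ a < pP ρ b :=
  add_lt_add hab (Real.rpow_lt_rpow ha hab (by linarith))

lemma pP_deriv {ρ a : ℝ} (hρ : 0 < ρ) (ha : 0 < a) : HasDerivAt (pP ρ) (1 + (1+ρ) * a^ρ) a := by
  have := (hasDerivAt_id a).add (Real.hasDerivAt_rpow_const (x := a) (p := 1+ρ) (Or.inl ha.ne'))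
  refine this.congr_deriv ?_
  simp

lemma pP_pos {ρ a : ℝ} (ha : 0 < a) : 0 < pP ρ a := by unfold pP; positivity

section dyn
variable {W δ : ℝ → ℝ} {ρ : ℝ}

lemma delta_anti (hmono : MonotoneOn W (Ioi 0)) (hδ : ∀ t, 0 < t → 0 < δ t ∧ W (δ t) = Real.exp (-t)) :
    StrictAntiOn δ (Ioi 0) := by
  intro a ha b hb hab
  by_contra h
  have h := not_lt.1 h
  have := hmono (hδ a ha).1 (hδ b hb).1 h
  rw [(hδ a ha).2, (hδ b hb).2, Real.exp_le_exp] at this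
  linarith

lemma delta_lim (hmono : MonotoneOn W (Ioi 0)) (hpos : ∀ s, 0 < s → 0 < W s)
    (hδ : ∀ t, 0 < t → 0 < δ t ∧ W (δ t) = Real.exp (-t)) : Tendsto δ atTop (𝓝[>] 0) := by
  refine tendsto_nhdsWithin_iff.2 ⟨?_, (eventually_gt_atTop 0).mono fun t ht => (hδ t ht).1⟩
  rw [tendsto_order]
  constructor
  · intro a ha
    filter_upwards [eventually_gt_atTop 0] with t ht using ha.trans (hδ t ht).1
  · intro a ha
    have : Tendsto (fun t : ℝ => Real.exp (-t)) atTop (𝓝 0) := Real.tendsto_exp_neg_atTop_nhds_zero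
    filter_upwards [eventually_gt_atTop 0, this.eventually_lt_const (hpos a ha)] with t ht h2
    by_contra h
    have := hmono ha (hδ t ht).1 (not_lt.1 h)
    rw [(hδ t ht).2] at this
    linarith

lemma lam_props (hmono : MonotoneOn W (Ioi 0)) 
    (hδ : ∀ t, 0 < t → 0 < δ t ∧ W (δ t) = Real.exp (-t)) :
    StrictMonoOn (fun t => Real.exp t / δ t) (Ioi 0) ∧ Tendsto (fun t => Real.exp t / δ t) atTop atTop := by
  have ha := delta_anti hmono hδ
  constructor
  · intro a h1 b h2 hab
    have := ha h1 h2 hab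
    exact div_lt_div₀ (Real.exp_lt_exp.2 hab) this.le (Real.exp_pos _).le (hδ b h2).1
  · have h1 : Tendsto (fun t => Real.exp t / δ 1) atTop atTop :=
      Real.tendsto_exp_atTop.atTop_div_const (hδ 1 one_pos).1
    refine tendsto_atTop_mono' _ ?_ h1
    filter_upwards [eventually_ge_atTop 1] with t ht
    have h0 : 0 < t := by linarith
    have := (hδ t h0).1
    have h3 := ha.antitoneOn (mem_Ioi.2 one_pos) (mem_Ioi.2 h0) ht
    gcongr

lemma q_lim (hρ : 0 < ρ) (hmono : MonotoneOn W (Ioi 0)) (hpos : ∀ s, 0 < s → 0 < W s)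
    (hratio : ∀ c, 0 < c → Tendsto (fun d => W (d * c) / W d) (𝓝[>] 0) (𝓝 (c ^ ρ)))
    (hδ : ∀ t, 0 < t → 0 < δ t ∧ W (δ t) = Real.exp (-t)) {a : ℝ} (ha : 0 < a) {q : ℝ → ℝ}
    (hq : ∀ t, 0 < t → 0 < q t ∧
      pP ρ a = q t + (1 - Real.exp (-t)) * (q t * (W (δ t * q t) / W (δ t)))) :
    Tendsto q atTop (𝓝 a) := by
  have hlim : ∀ b, 0 < b → Tendsto (fun t => b + (1 - Real.exp (-t)) * (b * (W (δ t * b) / W (δ t)))) atTop (𝓝 (pP ρ b)) := by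
    intro b hb
    have h1 := (hratio b hb).comp (delta_lim hmono hpos hδ)
    have h2 := ((Real.tendsto_exp_neg_atTop_nhds_zero.const_sub 1).mul (h1.const_mul b)).const_add b
    have e : b + (1 - 0) * (b * b^ρ) = pP ρ b := by
      rw [pP, Real.rpow_add hb, Real.rpow_one]; ring
    rw [e] at h2
    exact h2
  have hF : ∀ t, 0 < t → ∀ b c, 0 < b → b ≤ c → b + (1 - Real.exp (-t)) * (b * (W (δ t * b) / W (δ t)))
      ≤ c + (1 - Real.exp (-t)) * (c * (W (δ t * c) / W (δ t))) := by
    intro t ht b c hb hbc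
    have hd := (hδ t ht).1
    have hc : 0 < c := hb.trans_le hbc
    have h1 : 0 ≤ 1 - Real.exp (-t) := by simp [ht.le]
    have h2 : W (δ t * b) ≤ W (δ t * c) := hmono (mem_Ioi.2 (by positivity)) (mem_Ioi.2 (by positivity)) (by gcongr)
    have h3 := hpos _ hd
    have h4 := hpos (δ t * b) (by positivity)
    gcongr
  rw [tendsto_order]
  constructor
  · intro b hb
    rcases le_or_gt b 0 with h0 | h0
    · filter_upwards [eventually_gt_atTop 0] with t ht using h0.trans_lt (hq t ht).1
    · filter_upwards [eventually_gt_atTop 0, (hlim b h0).eventually_lt_const (pP_mono hρ h0.le hb)] with t ht h2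
      by_contra h
      have := hF t ht _ _ (hq t ht).1 (not_lt.1 h)
      rw [← (hq t ht).2] at this
      linarith
  · intro b hb
    filter_upwards [eventually_gt_atTop 0, (hlim b (ha.trans hb)).eventually_const_lt (pP_mono hρ ha.le hb)] with t ht h2
    by_contra h
    have := hF t ht _ _ (ha.trans hb) (not_lt.1 h)
    rw [← (hq t ht).2] at this
    linarith

end dyn

section sand
variable {ν : Measure ℝ}

lemma exp_sand {u p h : ℝ} (hh : 0 < h) :
    Real.exp (-(p*u)) - Real.exp (-((p+h)*u)) ≤ h * (u * Real.exp (-(p*u))) ∧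
    h * (u * Real.exp (-(p*u))) ≤ Real.exp (-((p-h)*u)) - Real.exp (-(p*u)) := by
  have e1 : Real.exp (-((p+h)*u)) = Real.exp (-(p*u)) * Real.exp (-(h*u)) := by
    rw [← Real.exp_add]; congr 1; ring
  have e2 : Real.exp (-((p-h)*u)) = Real.exp (-(p*u)) * Real.exp (h*u) := by
    rw [← Real.exp_add]; congr 1; ring
  rw [e1, e2]
  have h1 := Real.add_one_le_exp (-(h*u))
  have h2 := Real.add_one_le_exp (h*u)
  have h3 := Real.exp_pos (-(p*u))
  constructor <;> nlinarith

/-- scaled Laplace exponent -/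
def FF (ν : Measure ℝ) (lam p : ℝ) : ℝ := lam * ∫ y, (1 - Real.exp (-(p / lam * y))) ∂ν

lemma sand (h0 : ν (Iic 0) = 0) {lam : ℝ} (hl : 0 < lam)
    (hi : ∀ s, 0 < s → Integrable (fun y => 1 - Real.exp (-(s * y))) ν) {p q : ℝ} (hp : 0 < p)
    (hpq : p < q) :
    Integrable (fun y => y * Real.exp (-(q * (y / lam)))) ν ∧
    (q - p) * (∫ y, y * Real.exp (-(q * (y / lam))) ∂ν) ≤ FF ν lam q - FF ν lam p ∧
    (Integrable (fun y => y * Real.exp (-(p * (y / lam)))) ν →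
      FF ν lam q - FF ν lam p ≤ (q - p) * (∫ y, y * Real.exp (-(p * (y / lam))) ∂ν)) := by
  have hq := hp.trans hpq
  have hip := hi (p/lam) (by positivity)
  have hiq := hi (q/lam) (by positivity)
  have hF : FF ν lam q - FF ν lam p = ∫ y, lam * ((1 - Real.exp (-(q / lam * y))) - (1 - Real.exp (-(p / lam * y)))) ∂ν := by
    rw [FF, FF, integral_const_mul, integral_sub hiq hip]; ring
  have hD := (hiq.sub hip).const_mul lam
  have e : ∀ r y : ℝ, r / lam * y = r * (y / lam) := by intro r y; ring
  have key1 : ∀ y, (q - p) * (y * Real.exp (-(q * (y/lam)))) ≤ lam * ((1 - Real.exp (-(q / lam * y))) - (1 - Real.exp (-(p / lam * y)))) := by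
    intro y
    have := (exp_sand (u := y/lam) (p := q) (h := q - p) (by linarith)).2
    rw [sub_sub_cancel] at this
    rw [e, e]
    have h2 := mul_le_mul_of_nonneg_left this hl.le
    have e3 : lam * ((q-p) * (y / lam * Real.exp (-(q*(y/lam))))) = (q - p) * (y * Real.exp (-(q * (y/lam)))) := by
      field_simp
    rw [e3] at h2
    linarith
  have key2 : ∀ y, lam * ((1 - Real.exp (-(q / lam * y))) - (1 - Real.exp (-(p / lam * y)))) ≤ (q - p) * (y * Real.exp (-(p * (y/lam)))) := by
    intro y
    have := (exp_sand (u := y/lam) (p := p) (h := q - p) (by linarith)).1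
    rw [add_sub_cancel] at this
    rw [e, e]
    have h2 := mul_le_mul_of_nonneg_left this hl.le
    have e3 : lam * ((q-p) * (y / lam * Real.exp (-(p*(y/lam))))) = (q - p) * (y * Real.exp (-(p * (y/lam)))) := by
      field_simp
    rw [e3] at h2
    linarith
  have hI : Integrable (fun y => y * Real.exp (-(q * (y / lam)))) ν := by
    have : Integrable (fun y => (q-p) * (y * Real.exp (-(q * (y / lam))))) ν := by
      refine hD.mono' (by fun_prop) ?_
      filter_upwards [ae_pos' h0] with y hy
      rw [Real.norm_of_nonneg]
      · exact key1 y
      · have : 0 < q - p := by linarith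
        positivity
    refine (this.const_mul (q-p)⁻¹).congr (Eventually.of_forall fun y => ?_)
    have : q - p ≠ 0 := by linarith
    simp only
    rw [inv_mul_cancel_left₀ this]
  refine ⟨hI, ?_, fun hIp => ?_⟩
  · rw [hF, ← integral_const_mul]
    exact integral_mono (hI.const_mul _) hD key1
  · rw [hF, ← integral_const_mul]
    exact integral_mono hD (hIp.const_mul _) key2

lemma lap_lim {ν : ℝ → Measure ℝ} {lam : ℝ → ℝ} {ρ : ℝ} (hρ : 0 < ρ)
    (h0 : ∀ t, 0 < t → ν t (Iic 0) = 0) (hl : ∀ t, 0 < t → 0 < lam t)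
    (hi : ∀ t, 0 < t → ∀ s, 0 < s → Integrable (fun y => 1 - Real.exp (-(s * y))) (ν t))
    (hF : ∀ a, 0 < a → Tendsto (fun t => FF (ν t) (lam t) (pP ρ a)) atTop (𝓝 a)) {a : ℝ} (ha : 0 < a) :
    Tendsto (fun t => ∫ y, y * Real.exp (-(pP ρ a * (y / lam t))) ∂(ν t)) atTop
      (𝓝 (1 / (1 + (1+ρ) * a^ρ))) := by
  have hIntg : ∀ t, 0 < t → Integrable (fun y => y * Real.exp (-(pP ρ a * (y / lam t)))) (ν t) :=
    fun t ht => (sand (h0 t ht) (hl t ht) (hi t ht) (pP_pos (ρ := ρ) (show 0 < a/2 by positivity)) (pP_mono hρ (by positivity) (by linarith : a/2 < a))).1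
  have hs := (hasDerivAt_iff_tendsto_slope.1 (pP_deriv hρ ha)).inv₀ (by positivity)
  rw [← one_div] at hs
  have hq : ∀ b, 0 < b → Tendsto (fun t => (pP ρ b - pP ρ a)⁻¹ * (FF (ν t) (lam t) (pP ρ b) - FF (ν t) (lam t) (pP ρ a))) atTop (𝓝 ((slope (pP ρ) a b)⁻¹)) := by
    intro b hb
    have := ((hF b hb).sub (hF a ha)).const_mul (pP ρ b - pP ρ a)⁻¹
    rw [slope_def_field, inv_div, div_eq_inv_mul]
    exact this
  rw [tendsto_order]
  constructor
  · intro c hc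
    have h1 := (hs.mono_left (nhdsGT_le_nhdsNE a)).eventually_const_lt hc
    obtain ⟨b, hb1, hb2⟩ := (h1.and self_mem_nhdsWithin).exists
    have hb2 : a < b := hb2
    filter_upwards [(hq b (ha.trans hb2)).eventually_const_lt hb1, eventually_gt_atTop 0] with t h2 ht
    refine h2.trans_le ?_
    have hm := pP_mono hρ ha.le hb2
    rw [inv_mul_le_iff₀ (by linarith)]
    exact (sand (h0 t ht) (hl t ht) (hi t ht) (pP_pos ha) hm).2.2 (hIntg t ht)
  · intro c hc
    have h1 := (hs.mono_left (nhdsLT_le_nhdsNE a)).eventually_lt_const hc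
    obtain ⟨b, ⟨hb1, hb2⟩, hb3⟩ := ((h1.and self_mem_nhdsWithin).and (mem_nhdsWithin_of_mem_nhds (lt_mem_nhds ha))).exists
    have hb2 : b < a := hb2
    have hb3 : 0 < b := hb3
    filter_upwards [(hq b hb3).eventually_lt_const hb1, eventually_gt_atTop 0] with t h2 ht
    refine lt_of_le_of_lt ?_ h2
    have hm := pP_mono hρ hb3.le hb2
    have h3 := (sand (h0 t ht) (hl t ht) (hi t ht) (pP_pos hb3) hm).2.1
    have e : (pP ρ b - pP ρ a)⁻¹ * (FF (ν t) (lam t) (pP ρ b) - FF (ν t) (lam t) (pP ρ a))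
      = (pP ρ a - pP ρ b)⁻¹ * (FF (ν t) (lam t) (pP ρ a) - FF (ν t) (lam t) (pP ρ b)) := by
      rw [← neg_sub (pP ρ a), inv_neg]; ring
    rw [e, ← div_eq_inv_mul, le_div_iff₀ (by linarith)]
    linarith
end sand

lemma WW_lt_one {P : Measure ℝ} [IsProbabilityMeasure P] (hP : P (Iic 0) = 0) {s : ℝ} (hs : 0 < s) :
    WW P s < 1 := by
  have h0 : 0 ≤ᵐ[P] fun x => 1 - wF (s * x) := by
    filter_upwards [ae_pos hP] with x hx
    have := wF_lt_one (show 0 < s * x by positivity)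
    simp only [Pi.zero_apply]; linarith
  have hi : Integrable (fun x => 1 - wF (s * x)) P := (integrable_const 1).sub (wF_int hP hs)
  have he : ∫ x, (1 - wF (s * x)) ∂P = 1 - WW P s := by
    rw [integral_sub (integrable_const 1) (wF_int hP hs), WW]; simp
  have : 0 < ∫ x, (1 - wF (s * x)) ∂P := by
    refine lt_of_le_of_ne (integral_nonneg_of_ae h0) fun h => ?_
    have := (integral_eq_zero_iff_of_nonneg_ae h0 hi).1 h.symm
    have hF : ∀ᵐ x ∂P, False := by
      filter_upwards [this, ae_pos hP] with x h1 h2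
      have h3 := wF_lt_one (show 0 < s * x by positivity)
      simp only [Pi.zero_apply] at h1
      linarith
    simp at hF
    exact (IsProbabilityMeasure.ne_zero P) hF
  linarith

theorem additive_kernel_scaling_sufficiency
    -- ν₀ : positive measure on (0,∞) with total mass ∫ x ν₀(dx) = 1
    (ν₀ : Measure ℝ) (hν₀supp : ν₀ (Set.Iic 0) = 0)
    (hmass : ∫⁻ x, ENNReal.ofReal x ∂ν₀ = 1)
    -- desingularized Laplace transform of ν₀
    (φ₀ : ℝ → ℝ) (hφ₀ : ∀ s : ℝ, φ₀ s = ∫ x, (1 - Real.exp (-(s * x))) ∂ν₀)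
    -- characteristic map: σ(t,s) > 0 solves s = σ − (1 − e^{−t}) φ₀(σ)
    (σ : ℝ → ℝ → ℝ)
    (hσ : ∀ t : ℝ, 0 ≤ t → ∀ s : ℝ, 0 < s →
      0 < σ t s ∧ s = σ t s - (1 - Real.exp (-t)) * φ₀ (σ t s))
    -- (ν t) is the solution: its desingularized Laplace transform is e^{−t} φ₀(σ(t,s))
    (ν : ℝ → Measure ℝ)
    (hsol : ∀ t : ℝ, 0 ≤ t → (ν t) (Set.Iic 0) = 0 ∧
      ∀ s : ℝ, 0 < s →
        ∫ x, (1 - Real.exp (-(s * x))) ∂(ν t) = Real.exp (-t) * φ₀ (σ t s))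
    -- mass distribution function M(t,x) = ∫₀^x y ν_t(dy)
    (M : ℝ → ℝ → ℝ)
    (hM : ∀ t : ℝ, 0 ≤ t → ∀ x : ℝ, M t x = ∫ y in Set.Ioc (0:ℝ) x, y ∂(ν t))
    -- hypothesis: ∫₀^x y² ν₀(dy) ~ x^{1-ρ} L(x) as x → ∞ with ρ ∈ (0,1], L slowly varying
    (ρ : ℝ) (hρ : ρ ∈ Set.Ioc (0:ℝ) 1)
    (L : ℝ → ℝ)
    (hLpos : ∀ x : ℝ, 0 < x → 0 < L x)
    (hLslow : ∀ c : ℝ, 0 < c → Tendsto (fun x => L (c * x) / L x) atTop (𝓝 1))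
    (htail : Tendsto (fun x => (∫ y in Set.Ioc (0:ℝ) x, y ^ 2 ∂ν₀) / (x ^ (1 - ρ) * L x))
      atTop (𝓝 1)) :
    -- conclusion: strictly increasing rescaling λ(t) → ∞ with
    -- M(t, λ(t) x) → M_ρ(x) for all x ∈ [0,∞)
    ∃ lam : ℝ → ℝ, StrictMonoOn lam (Set.Ioi 0) ∧ Tendsto lam atTop atTop ∧
      ∀ x : ℝ, 0 ≤ x →
        Tendsto (fun t => M t (lam t * x)) atTop (𝓝 (addSelfSimilarCDF ρ x)) := by
  obtain ⟨hρ0, hρ1⟩ := hρ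
  haveI := szb_prob hmass
  set P := szb ν₀ with hPdef
  have hP : P (Iic 0) = 0 := szb_zero hν₀supp
  have htail' : Tendsto (fun x => UU P x / (x ^ (1 - ρ) * L x)) atTop (𝓝 1) := by
    simpa only [U_eq] using htail
  obtain ⟨hUp, hUr⟩ := rv_of_tail hLpos hLslow htail'
  have hmono := WW_mono hP
  have hpos : ∀ s, 0 < s → 0 < WW P s := fun s hs => WW_pos hP hs
  have hratio : ∀ c, 0 < c → Tendsto (fun d => WW P (d * c) / WW P d) (𝓝[>] 0) (𝓝 (c ^ ρ)) :=
    fun c hc => WW_ratio hP hρ0 hρ1 hUr hUp hc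
  have hφ : ∀ s, 0 < s → φ₀ s = s * (1 - WW P s) := fun s hs => by
    rw [hφ₀, phi_eq hν₀supp hmass hs]
  have hW1 : ∀ s, 0 < s → WW P s < 1 := fun s hs => WW_lt_one hP hs
  -- choice of δ
  have hex : ∀ t : ℝ, ∃ d, 0 < t → 0 < d ∧ WW P d = Real.exp (-t) := by
    intro t
    by_cases ht : 0 < t
    · have he1 : Real.exp (-t) < 1 := by simpa using ht
      obtain ⟨a, ha1, ha2⟩ := (((WW_zero hP).eventually_lt_const (Real.exp_pos (-t))).and self_mem_nhdsWithin).exists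
      obtain ⟨b, hb1, hb2⟩ := (((WW_top hP).eventually_const_lt he1).and (eventually_gt_atTop 0)).exists
      obtain ⟨d, hd, hde⟩ := isPreconnected_Ioi.intermediate_value ha2 (mem_Ioi.2 hb2) (WW_cont hP) ⟨ha1.le, hb1.le⟩
      exact ⟨d, fun _ => ⟨hd, hde⟩⟩
    · exact ⟨0, fun h => absurd h ht⟩
  choose δ hδ using hex
  obtain ⟨hl1, hl2⟩ := lam_props hmono hδ
  set lam : ℝ → ℝ := fun t => Real.exp t / δ t with hlam
  have hlpos : ∀ t, 0 < t → 0 < lam t := fun t ht => div_pos (Real.exp_pos _) (hδ t ht).1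
  refine ⟨lam, hl1, hl2, ?_⟩
  have hν0 : ∀ t, 0 < t → ν t (Iic 0) = 0 := fun t ht => (hsol t ht.le).1
  have hi : ∀ t, 0 < t → ∀ s, 0 < s → Integrable (fun y => 1 - Real.exp (-(s * y))) (ν t) := by
    intro t ht s hs
    by_contra h
    have h1 := (hsol t ht.le).2 s hs
    rw [integral_undef h] at h1
    have hσ1 := (hσ t ht.le s hs).1
    rw [hφ _ hσ1] at h1
    have : 0 < Real.exp (-t) * (σ t s * (1 - WW P (σ t s))) :=
      mul_pos (Real.exp_pos _) (mul_pos hσ1 (by linarith [hW1 _ hσ1]))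
    linarith
  have hF : ∀ a, 0 < a → Tendsto (fun t => FF (ν t) (lam t) (pP ρ a)) atTop (𝓝 a) := by
    intro a ha
    set q : ℝ → ℝ := fun t => σ t (pP ρ a / lam t) / δ t with hqdef
    have hs : ∀ t, 0 < t → 0 < pP ρ a / lam t := fun t ht => div_pos (pP_pos ha) (hlpos t ht)
    have hσq : ∀ t, 0 < t → σ t (pP ρ a / lam t) = δ t * q t := by
      intro t ht
      have := (hδ t ht).1.ne'
      simp only [hqdef]; field_simp
    have hq : ∀ t, 0 < t → 0 < q t ∧
        pP ρ a = q t + (1 - Real.exp (-t)) * (q t * (WW P (δ t * q t) / WW P (δ t))) := by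
      intro t ht
      obtain ⟨hσ1, hσ2⟩ := hσ t ht.le _ (hs t ht)
      obtain ⟨hd, hWd⟩ := hδ t ht
      refine ⟨div_pos hσ1 hd, ?_⟩
      rw [hφ _ hσ1, hσq t ht] at hσ2
      rw [hWd]
      have hl := (hlpos t ht).ne'
      have e1 : pP ρ a = (pP ρ a / lam t) * lam t := by field_simp
      rw [e1, hσ2]
      simp only [hlam]
      rw [Real.exp_neg]
      have := Real.exp_pos t
      generalize WW P (δ t * q t) = w
      generalize q t = z
      field_simp
      ring
    have hql := q_lim hρ0 hmono hpos hratio hδ ha hq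
    have hδl := delta_lim hmono hpos hδ
    have hδq : Tendsto (fun t => δ t * q t) atTop (𝓝[>] 0) := by
      refine tendsto_nhdsWithin_iff.2 ⟨?_, ?_⟩
      · simpa using (hδl.mono_right nhdsWithin_le_nhds).mul hql
      · filter_upwards [eventually_gt_atTop 0] with t ht
        exact mul_pos (hδ t ht).1 (hq t ht).1
    have h3 := hql.mul (((WW_zero hP).comp hδq).const_sub 1)
    simp only [sub_zero, mul_one] at h3
    refine h3.congr' ?_
    filter_upwards [eventually_gt_atTop 0] with t ht
    have hσ1 := (hσ t ht.le _ (hs t ht)).1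
    rw [FF, (hsol t ht.le).2 _ (hs t ht), hφ _ hσ1, hσq t ht]
    simp only [hlam, Function.comp]
    rw [Real.exp_neg]
    have := Real.exp_pos t
    have := (hδ t ht).1
    field_simp
  -- the limiting measures
  set μ : ℝ → Measure ℝ := fun t => (szb (ν t)).map (fun y => y / lam t) with hμ
  have hmeas : ∀ t, Measurable fun y : ℝ => y / lam t := fun t => measurable_id.div_const _
  have hμ0 : ∀ᶠ t in atTop, μ t (Iic 0) = 0 := by
    filter_upwards [eventually_gt_atTop 0] with t ht
    rw [hμ]
    simp only
    rw [Measure.map_apply (hmeas t) measurableSet_Iic]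
    have : (fun y : ℝ => y / lam t) ⁻¹' Iic 0 = Iic 0 := by
      ext y
      simp only [mem_preimage, mem_Iic, div_le_iff₀ (hlpos t ht), zero_mul]
    rw [this]
    exact szb_zero (hν0 t ht)
  have hμexp : ∀ t, 0 < t → ∀ p, ∫ x, Real.exp (-(p * x)) ∂(μ t) = ∫ y, y * Real.exp (-(p * (y / lam t))) ∂(ν t) := by
    intro t ht p
    rw [hμ]
    simp only
    rw [integral_map (hmeas t).aemeasurable (by fun_prop), szb_integral (hν0 t ht)]
  have hlap : ∀ a, 0 < a → Tendsto (fun t => ∫ x, Real.exp (-(pP ρ a * x)) ∂(μ t)) atTop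
      (𝓝 (1 / (1 + (1+ρ) * a^ρ))) := by
    intro a ha
    refine (lap_lim hρ0 hν0 hlpos hi hF ha).congr' ?_
    filter_upwards [eventually_gt_atTop 0] with t ht
    rw [hμexp t ht]
  set a₀ : ℝ := (3:ℝ) ^ (1/ρ) with ha₀
  have ha₀pos : 0 < a₀ := by positivity
  have ha₀ρ : a₀ ^ ρ = 3 := by
    rw [ha₀, ← Real.rpow_mul (by norm_num)]
    rw [one_div, inv_mul_cancel₀ hρ0.ne', Real.rpow_one]
  have hβ0 : 0 < ρ / (1+ρ) := by positivity
  have hβ1 : ρ / (1+ρ) < 1 := by rw [div_lt_one (by positivity)]; linarith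
  obtain ⟨hb1, hb2, -⟩ := mD_laplace_eq hρ0 ha₀pos ha₀ρ.ge
  have hiμ : ∀ᶠ t in atTop, Integrable (fun x => Real.exp (-(pP ρ a₀ * x))) (μ t) := by
    filter_upwards [eventually_gt_atTop 0] with t ht
    rw [hμ]
    simp only
    rw [integrable_map_measure (by fun_prop) (hmeas t).aemeasurable]
    refine szb_integrable (hν0 t ht) ?_
    exact (sand (hν0 t ht) (hlpos t ht) (hi t ht) (pP_pos (ρ := ρ) (show 0 < a₀/2 by positivity)) (pP_mono hρ0 (by positivity) (by linarith : a₀/2 < a₀))).1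
  have hL : ∀ n : ℕ, Tendsto (fun t => ∫ x, Real.exp (-((pP ρ a₀ + n) * x)) ∂(μ t)) atTop
      (𝓝 (∫ x in Ioi 0, Real.exp (-((pP ρ a₀ + n) * x)) * mD (ρ/(1+ρ)) x)) := by
    intro n
    obtain ⟨a, ha1, ha2⟩ : ∃ a, a₀ ≤ a ∧ pP ρ a = pP ρ a₀ + n := by
      have hc : ContinuousOn (pP ρ) (Icc a₀ (a₀ + n)) := fun x hx =>
        (pP_deriv hρ0 (ha₀pos.trans_le hx.1)).continuousAt.continuousWithinAt
      have hn : (0:ℝ) ≤ n := Nat.cast_nonneg n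
      have hle : a₀ ^ (1+ρ) ≤ (a₀ + n)^(1+ρ) := by gcongr; linarith
      obtain ⟨a, ha, h⟩ := intermediate_value_Icc (by linarith) hc
        (show pP ρ a₀ + n ∈ Icc (pP ρ a₀) (pP ρ (a₀+n)) from ⟨by linarith, by unfold pP; linarith⟩)
      exact ⟨a, ha.1, h⟩
    have hapos := ha₀pos.trans_le ha1
    have ha3 : 3 ≤ a ^ ρ := by
      rw [← ha₀ρ]; gcongr
    rw [← ha2]
    have := (mD_laplace_eq hρ0 hapos ha3).2.2
    have h4 := hlap a hapos
    rw [← this] at h4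
    exact h4
  have hkar := karamata_lim hμ0 hiμ hb2 hL
  intro x hx
  rcases hx.eq_or_lt with rfl | hx
  · have e1 : addSelfSimilarCDF ρ 0 = 0 := by
      rw [cdf_eq]
      have : ∀ k : ℕ, cS (ρ/(1+ρ)) k * (0:ℝ) ^ (((k:ℝ)+1) * (ρ/(1+ρ))) = 0 := by
        intro k
        rw [Real.zero_rpow (by positivity), mul_zero]
      simp only [this, tsum_zero]
    rw [e1]
    refine tendsto_const_nhds.congr' ?_
    filter_upwards [eventually_gt_atTop 0] with t ht
    rw [hM t ht.le]; simp
  · have h5 := hkar x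
    rw [mD_cdf hβ0 hβ1 (pP_pos ha₀pos) hb1 hx, ← cdf_eq] at h5
    refine h5.congr' ?_
    filter_upwards [eventually_gt_atTop 0] with t ht
    rw [hM t ht.le, hμ]
    simp only
    rw [Measure.real, Measure.map_apply (hmeas t) measurableSet_Ioc]
    have : (fun y : ℝ => y / lam t) ⁻¹' Ioc 0 x = Ioc 0 (lam t * x) := by
      ext y
      simp only [mem_preimage, mem_Ioc, div_le_iff₀ (hlpos t ht), mul_comm x]
      rw [div_pos_iff_of_pos_right (hlpos t ht)]
    rw [this, szb, withDensity_apply _ measurableSet_Ioc, integral_eq_lintegral_of_nonneg_ae]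
    · exact (ae_restrict_iff' measurableSet_Ioc).2 (Eventually.of_forall fun y hy => hy.1.le)
    · exact measurable_id.aestronglyMeasurable
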